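/- arXiv:2304.03166 — 7 statements merged into one kernel-verified Lean document; each statement's English description precedes it below -/
import Mathlib

section
/- Let p be a prime and let K be a field of characteristic p that is complete with respect to a nontrivial nonarchimedean absolute value ‖·‖ (for instance a nonarchimedean local field F_q((t))). Let A be a commutative unital Banach K-algebra whose norm is nonarchimedean (‖a+b‖ ≤ max(‖a‖,‖b‖)) and which is an integral domain. Let U = {z ∈ K : ‖z−1‖ < 1}, a group under multiplication. Suppose χ : K → A satisfies: χ(1) = 1; χ(z·w) = χ(z)·χ(w) for all z, w ∈ U; and χ is analytic at every point of U (AnalyticAt K χ z for all z ∈ U). Then there exists a unique c ∈ ℤ_p (the p-adic integers) such that for every z ∈ U the series ∑_{n≥0} binom(c,n)·(z−1)^n converges in A with sum χ(z) (i.e. HasSum (fun n => (binom(c,n) : A)·(z−1)^n) (χ z)); in particular ‖χ(z) − 1‖ < 1 for every z ∈ U. -/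
open Filter Topology

theorem hasSum_congr {ι M : Type*} [AddCommMonoid M] [TopologicalSpace M] {f g : ι → M} {s : M}
    (h : ∀ i, f i = g i) : HasSum f s ↔ HasSum g s := by
  rw [funext h]

section PowerSeries

variable {K A : Type*} [NontriviallyNormedField K] [NormedCommRing A] [NormedAlgebra K A]

/-- The one-variable power series with prescribed coefficients. -/
noncomputable def FormalMultilinearSeries.ofCoeff (K : Type*) {A : Type*}
    [NontriviallyNormedField K] [NormedCommRing A] [NormedAlgebra K A] (a : ℕ → A) :
    FormalMultilinearSeries K K A :=
  fun n => ContinuousMultilinearMap.mkPiRing K (Fin n) (a n)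

theorem FormalMultilinearSeries.coeff_ofCoeff (a : ℕ → A) (n : ℕ) :
    (FormalMultilinearSeries.ofCoeff K a).coeff n = a n := by
  simp [FormalMultilinearSeries.coeff, FormalMultilinearSeries.ofCoeff]

theorem hasFPowerSeriesAt_ofCoeff_of_eventually_hasSum {a : ℕ → A} {f : K → A} {z₀ : K}
    (h : ∀ᶠ z in 𝓝 z₀, HasSum (fun n => a n * algebraMap K A (z - z₀) ^ n) (f z)) :
    HasFPowerSeriesAt f (FormalMultilinearSeries.ofCoeff K a) z₀ := by
  rw [hasFPowerSeriesAt_iff']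
  filter_upwards [h] with z hz
  refine (hasSum_congr fun n => ?_).1 hz
  rw [FormalMultilinearSeries.coeff_ofCoeff, Algebra.smul_def, map_pow, mul_comm]

theorem coeff_eq_of_eventually_hasSum {a b : ℕ → A} {f : K → A} {z₀ : K}
    (ha : ∀ᶠ z in 𝓝 z₀, HasSum (fun n => a n * algebraMap K A (z - z₀) ^ n) (f z))
    (hb : ∀ᶠ z in 𝓝 z₀, HasSum (fun n => b n * algebraMap K A (z - z₀) ^ n) (f z)) :
    a = b := by
  have h := (hasFPowerSeriesAt_ofCoeff_of_eventually_hasSum ha).eq_formalMultilinearSeries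
    (hasFPowerSeriesAt_ofCoeff_of_eventually_hasSum hb)
  funext n
  rw [← FormalMultilinearSeries.coeff_ofCoeff (K := K) a n, h,
    FormalMultilinearSeries.coeff_ofCoeff]

theorem eventually_hasSum_deriv [CompleteSpace A] {a : ℕ → A} {f : K → A} {z₀ : K}
    (h : ∀ᶠ z in 𝓝 z₀, HasSum (fun n => a n * algebraMap K A (z - z₀) ^ n) (f z)) :
    ∀ᶠ z in 𝓝 z₀,
      HasSum (fun n => ((n + 1 : ℕ) : A) * a (n + 1) * algebraMap K A (z - z₀) ^ n)
        (deriv f z) := by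
  obtain ⟨r, hr⟩ := hasFPowerSeriesAt_ofCoeff_of_eventually_hasSum h
  have h' := hasFPowerSeriesAt_iff'.1 hr.fderiv.hasFPowerSeriesAt
  filter_upwards [h'] with z hz
  refine (hasSum_congr fun n => ?_).1 (hz.mapL (ContinuousLinearMap.apply K A (1 : K)))
  rw [ContinuousLinearMap.apply_apply, smul_apply,
    FormalMultilinearSeries.derivSeries_coeff_one, FormalMultilinearSeries.coeff_ofCoeff,
    Algebra.smul_def, nsmul_eq_mul, map_pow]
  ring

theorem hasSum_mul_pow_of_hasSum_succ {a : ℕ → A} {x s : A} (h0 : a 0 = 0)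
    (h : HasSum (fun n => a (n + 1) * x ^ n) s) : HasSum (fun n => a n * x ^ n) (x * s) := by
  have h' := (hasSum_congr fun n => (by ring : x * (a (n + 1) * x ^ n) =
    a (n + 1) * x ^ (n + 1))).1 (h.mul_left x)
  simpa [h0] using (hasSum_nat_add_iff (f := fun n => a n * x ^ n) 1).1 h'

theorem hasSum_extend_mul_pow {a : ℕ → A} {x s : A} {p : ℕ} (hp : p ≠ 0)
    (h : HasSum (fun n => a n * (x ^ p) ^ n) s) :
    HasSum (fun n => Function.extend (p * ·) a 0 n * x ^ n) s := by
  have hinj : Function.Injective (p * ·) := mul_right_injective₀ hp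
  rw [← hasSum_extend_zero hinj] at h
  refine (hasSum_congr fun n => ?_).1 h
  by_cases hn : ∃ m, p * m = n
  · obtain ⟨m, rfl⟩ := hn
    rw [hinj.extend_apply, hinj.extend_apply, pow_mul]
  · rw [Function.extend_apply' _ _ _ hn, Function.extend_apply' _ _ _ hn]
    simp

theorem eq_coeff_zero_of_hasSum {a : ℕ → A} {s : A}
    (h : HasSum (fun n => a n * (0 : A) ^ n) s) : s = a 0 := by
  refine h.unique ?_
  simpa using hasSum_single (f := fun n => a n * (0 : A) ^ n) 0 fun n hn => by simp [hn]

theorem summable_mul_pow_of_norm_le_one [NormOneClass A] [CompleteSpace A] {a : ℕ → A}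
    (ha : ∀ n, ‖a n‖ ≤ 1) {x : K} (hx : ‖x‖ < 1) :
    Summable (fun n => a n * algebraMap K A x ^ n) := by
  refine Summable.of_norm_bounded (summable_geometric_of_lt_one (norm_nonneg x) hx) fun n => ?_
  rw [← map_pow]
  refine (norm_mul_le _ _).trans ?_
  rw [norm_algebraMap', norm_pow]
  exact mul_le_of_le_one_left (by positivity) (ha n)

end PowerSeries

theorem norm_natCast_le_one_of_normedAlgebra (K : Type*) {A : Type*} [NontriviallyNormedField K]
    [IsUltrametricDist K] [NormedCommRing A] [NormOneClass A] [NormedAlgebra K A] (n : ℕ) :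
    ‖(n : A)‖ ≤ 1 := by
  rw [← map_natCast (algebraMap K A), norm_algebraMap']
  exact IsUltrametricDist.norm_natCast_le_one K n

section PrimeCharacteristic

theorem exists_natCast_eq_of_pow_eq_self {A : Type*} [CommRing A] [IsDomain A] (p : ℕ)
    [hp : Fact p.Prime] [CharP A p] {a : A} (ha : a ^ p = a) : ∃ i < p, (i : A) = a := by
  have h : algebraMap A (FractionRing A) a ^ p = algebraMap A (FractionRing A) a := by
    rw [← map_pow, ha]
  have : CharP (FractionRing A) p :=
    charP_of_injective_algebraMap (IsFractionRing.injective A (FractionRing A)) p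
  have hmem := (Subfield.mem_bot_iff_pow_eq_self (FractionRing A) p).2 h
  rw [mem_bot_iff_intCast p] at hmem
  obtain ⟨n, hn⟩ := hmem
  have hna : (n : A) = a :=
    IsFractionRing.injective A (FractionRing A) (by rw [map_intCast, hn])
  have hpos : (p : ℤ) ≠ 0 := mod_cast hp.out.ne_zero
  have hlt := Int.emod_lt_of_pos n (Nat.cast_pos.2 hp.out.pos : (0 : ℤ) < p)
  refine ⟨(n % p).toNat, by omega, ?_⟩
  rw [← hna, ← Int.cast_natCast, Int.toNat_of_nonneg (Int.emod_nonneg n hpos)]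
  exact (CharP.intCast_eq_intCast A p).2 (Int.mod_modEq n p)

theorem natCast_choose_eq_of_modEq {A : Type*} [CommRing A] (p : ℕ) [hp : Fact p.Prime]
    [CharP A p] {k : ℕ} :
    ∀ {r s n : ℕ}, r ≡ s [MOD p ^ k] → n < p ^ k → (r.choose n : A) = s.choose n := by
  induction k with
  | zero =>
    intro r s n _ hn
    obtain rfl : n = 0 := by simpa using hn
    simp
  | succ k ih =>
    intro r s n h hn
    have lucas (m : ℕ) : (m.choose n : A) =
        (m % p).choose (n % p) * (m / p).choose (n / p) := by
      rw [← Nat.cast_mul]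
      exact (CharP.natCast_eq_natCast A p).2 Choose.choose_modEq_choose_mod_mul_choose_div_nat
    have h1 : r % p = s % p := h.of_dvd (dvd_pow_self p k.succ_ne_zero)
    have h2 : r / p ≡ s / p [MOD p ^ k] := by
      have := congrArg (· / p) (show r % p ^ (k + 1) = s % p ^ (k + 1) from h)
      simpa [Nat.ModEq, pow_succ, Nat.mod_mul_left_div_self] using this
    rw [lucas r, lucas s, h1, ih h2 (Nat.div_lt_of_lt_mul (by rwa [pow_succ'] at hn))]

theorem modEq_of_forall_natCast_choose_eq {A : Type*} [CommRing A] [Nontrivial A] (p : ℕ)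
    [hp : Fact p.Prime] [CharP A p] {k r s : ℕ}
    (h : ∀ n < p ^ k, (r.choose n : A) = s.choose n) : r ≡ s [MOD p ^ k] := by
  wlog hle : r % p ^ k ≤ s % p ^ k generalizing r s
  · exact (this (fun n hn => (h n hn).symm) (le_of_not_ge hle)).symm
  rcases hle.eq_or_lt with heq | hlt
  · exact heq
  have hs : s % p ^ k < p ^ k := Nat.mod_lt _ (pow_pos hp.out.pos k)
  have := h _ hs
  rw [natCast_choose_eq_of_modEq p (Nat.mod_modEq r _).symm hs,
    natCast_choose_eq_of_modEq p (Nat.mod_modEq s _).symm hs, Nat.choose_eq_zero_of_lt hlt] at this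
  simp at this

end PrimeCharacteristic

section PadicInt

variable {p : ℕ} [hp : Fact p.Prime]

theorem PadicInt.exists_forall_modEq_appr {r : ℕ → ℕ}
    (h : ∀ k, r (k + 1) ≡ r k [MOD p ^ k]) : ∃ c : ℤ_[p], ∀ k, r k ≡ c.appr k [MOD p ^ k] := by
  have hle {m n : ℕ} (hmn : m ≤ n) : r m ≡ r n [MOD p ^ m] := by
    induction n, hmn using Nat.le_induction with
    | base => rfl
    | succ n hmn ih => exact ih.trans ((h n).symm.of_dvd (pow_dvd_pow p hmn))
  obtain ⟨c, hc⟩ := IsPrecomplete.prec' (I := IsLocalRing.maximalIdeal ℤ_[p])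
    (fun k => (r k : ℤ_[p])) fun {m n} hmn => by
      rw [SModEq.sub_mem, PadicInt.maximalIdeal_eq_span_p, smul_eq_mul, Ideal.mul_top,
        Ideal.span_singleton_pow, Ideal.mem_span_singleton]
      have := Nat.modEq_iff_dvd.1 (hle hmn).symm
      rw [Nat.cast_pow, ← PadicInt.pow_p_dvd_int_iff] at this
      exact_mod_cast this
  refine ⟨c, fun k => ?_⟩
  have hck := hc k
  rw [SModEq.comm, SModEq.sub_mem, PadicInt.maximalIdeal_eq_span_p, smul_eq_mul, Ideal.mul_top,
    Ideal.span_singleton_pow] at hck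
  exact (ZMod.natCast_eq_natCast_iff _ _ _).1
    (PadicInt.zmod_congr_of_sub_mem_span k c _ _ hck (PadicInt.appr_spec k c))

end PadicInt

section LocalCharacter

variable {K A : Type*} [NontriviallyNormedField K] [NormedCommRing A] [NormedAlgebra K A]

/-- `χ` is multiplicative near `1` and has power series expansion `∑ aₙ (z - 1) ^ n` there. -/
structure IsLocalAnalyticCharacter (χ : K → A) (a : ℕ → A) : Prop where
  map_one : χ 1 = 1
  eventually_map_mul : ∀ᶠ q : K × K in 𝓝 (1, 1), χ (q.1 * q.2) = χ q.1 * χ q.2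
  eventually_hasSum :
    ∀ᶠ z in 𝓝 (1 : K), HasSum (fun n => a n * algebraMap K A (z - 1) ^ n) (χ z)

namespace IsLocalAnalyticCharacter

variable {χ : K → A} {a : ℕ → A}

theorem coeff_zero (h : IsLocalAnalyticCharacter χ a) : a 0 = 1 := by
  have h1 := h.eventually_hasSum.self_of_nhds
  rw [sub_self, _root_.map_zero] at h1
  rw [← eq_coeff_zero_of_hasSum h1, h.map_one]

theorem eventually_map_pow (h : IsLocalAnalyticCharacter χ a) (m : ℕ) :
    ∀ᶠ z in 𝓝 (1 : K), χ (z ^ m) = χ z ^ m := by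
  induction m with
  | zero => simp [h.map_one]
  | succ m ih =>
    have ht : Tendsto (fun z : K => (z ^ m, z)) (𝓝 1) (𝓝 (1, 1)) := by
      have : ContinuousAt (fun z : K => (z ^ m, z)) 1 := by fun_prop
      simpa [ContinuousAt] using this
    filter_upwards [ih, ht.eventually h.eventually_map_mul] with z h1 h2
    rw [pow_succ, h2, h1, pow_succ]

theorem coeff_recurrence [CompleteSpace A] (h : IsLocalAnalyticCharacter χ a) (n : ℕ) :
    ((n + 1 : ℕ) : A) * a (n + 1) = (a 1 - n) * a n := by
  have hderiv := eventually_hasSum_deriv h.eventually_hasSum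
  have hderiv_one : deriv χ 1 = a 1 := by
    have h1 := hderiv.self_of_nhds
    rw [sub_self, _root_.map_zero] at h1
    simpa using eq_coeff_zero_of_hasSum (a := fun n => ((n + 1 : ℕ) : A) * a (n + 1)) h1
  have hdiff : ∀ᶠ z in 𝓝 (1 : K), DifferentiableAt K χ z :=
    (hasFPowerSeriesAt_ofCoeff_of_eventually_hasSum
      h.eventually_hasSum).analyticAt.eventually_analyticAt.mono fun z hz => hz.differentiableAt
  have hode : ∀ᶠ z in 𝓝 (1 : K), algebraMap K A z * deriv χ z = a 1 * χ z := by
    filter_upwards [hdiff, h.eventually_map_mul.curry_nhds] with z hz hzw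
    have h1 : HasDerivAt (fun w => χ (z * w)) (z • deriv χ z) 1 := by
      have hz' : HasDerivAt χ (deriv χ z) (z * 1) := by simpa using hz.hasDerivAt
      have hl : HasDerivAt (fun w : K => z * w) z 1 := by
        simpa using (hasDerivAt_id (1 : K)).const_mul z
      exact hz'.scomp 1 hl
    have h2 : HasDerivAt (fun w => χ z * χ w) (χ z * a 1) 1 := by
      rw [← hderiv_one]
      exact hdiff.self_of_nhds.hasDerivAt.const_mul (χ z)
    rw [← Algebra.smul_def, mul_comm (a 1)]
    exact h1.unique (h2.congr_of_eventuallyEq hzw)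
  have key := coeff_eq_of_eventually_hasSum (z₀ := (1 : K))
    (f := fun z => algebraMap K A z * deriv χ z)
    (a := fun n => ((n + 1 : ℕ) : A) * a (n + 1) + (n : A) * a n) (b := fun n => a 1 * a n)
    (by
      filter_upwards [hderiv] with z hz
      have hz' := hasSum_mul_pow_of_hasSum_succ (a := fun n => (n : A) * a n) (by simp) hz
      have hsum : algebraMap K A z * deriv χ z =
          deriv χ z + algebraMap K A (z - 1) * deriv χ z := by
        rw [map_sub, _root_.map_one]
        ring
      rw [hsum]
      exact (hasSum_congr fun n => by ring).1 (hz.add hz'))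
    (by
      filter_upwards [h.eventually_hasSum, hode] with z hz hz'
      rw [hz']
      exact (hasSum_congr fun n => by ring).1 (hz.mul_left (a 1)))
  linear_combination congrFun key n

theorem coeff_block [IsDomain A] [CompleteSpace A] (p : ℕ) [CharP A p]
    (h : IsLocalAnalyticCharacter χ a) {c : ℕ} (hc : (c : A) = a 1)
    (m : ℕ) : ∀ i < p, a (p * m + i) = a (p * m) * c.choose i := by
  intro i
  induction i with
  | zero => simp
  | succ i ih =>
    intro hi
    have hrec := h.coeff_recurrence (p * m + i)
    have hchoose : ((c.choose (i + 1) : ℕ) : A) * (i + 1) = c.choose i * (c - i) := by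
      rcases le_or_gt i c with hle | hlt
      · rw [← Nat.cast_sub hle]
        exact_mod_cast congrArg (Nat.cast (R := A)) (Nat.choose_succ_right_eq c i)
      · simp [Nat.choose_eq_zero_of_lt hlt, Nat.choose_eq_zero_of_lt (Nat.lt_succ_of_lt hlt)]
    have hne : ((i + 1 : ℕ) : A) ≠ 0 := fun h0 =>
      Nat.not_dvd_of_pos_of_lt i.succ_pos hi ((CharP.cast_eq_zero_iff A p _).1 h0)
    rw [ih (Nat.lt_of_succ_lt hi), ← hc] at hrec
    push_cast [CharP.cast_eq_zero] at hrec hne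
    rw [← add_assoc]
    refine mul_left_cancel₀ hne ?_
    linear_combination hrec - a (p * m) * hchoose

theorem coeff_eq_mul_choose [IsDomain A] [CompleteSpace A] (p : ℕ)
    [hp : Fact p.Prime] [CharP A p] (h : IsLocalAnalyticCharacter χ a) {c r n : ℕ}
    (hcp : c < p) (hc : (c : A) = a 1) (hr : a (p * (n / p)) = r.choose (n / p)) :
    a n = (c + p * r).choose n := by
  have hlucas : (((c + p * r).choose n : ℕ) : A) =
      (c.choose (n % p) : ℕ) * (r.choose (n / p) : ℕ) := by
    have := (CharP.natCast_eq_natCast A p).2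
      (Choose.choose_modEq_choose_mod_mul_choose_div_nat (n := c + p * r) (k := n) (p := p))
    rwa [Nat.add_mul_mod_self_left, Nat.mod_eq_of_lt hcp, Nat.add_mul_div_left _ _ hp.out.pos,
      Nat.div_eq_of_lt hcp, zero_add, Nat.cast_mul] at this
  have := h.coeff_block p hc (n / p) (n % p) (Nat.mod_lt _ hp.out.pos)
  rw [Nat.div_add_mod, hr] at this
  rw [this, hlucas, mul_comm]

variable (p : ℕ) [hp : Fact p.Prime] [CharP K p] [CharP A p]

theorem coeff_pow_char (h : IsLocalAnalyticCharacter χ a) (n : ℕ) : a n ^ p = a n := by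
  have hinj : Function.Injective (p * ·) := mul_right_injective₀ hp.out.ne_zero
  have ht : Tendsto (fun z : K => z ^ p) (𝓝 1) (𝓝 1) := by
    simpa using (continuous_pow p).tendsto (1 : K)
  have key := coeff_eq_of_eventually_hasSum (z₀ := (1 : K)) (f := fun z => χ z ^ p)
    (a := Function.extend (p * ·) (fun n => a n ^ p) 0) (b := Function.extend (p * ·) a 0)
    (by
      filter_upwards [h.eventually_hasSum] with z hz
      refine hasSum_extend_mul_pow hp.out.ne_zero ?_
      refine (hasSum_congr fun n => ?_).1 (hz.map (frobenius A p) (continuous_pow p))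
      rw [Function.comp_apply, frobenius_def, mul_pow, pow_right_comm])
    (by
      filter_upwards [ht.eventually h.eventually_hasSum, h.eventually_map_pow p] with z hz hz'
      refine hasSum_extend_mul_pow hp.out.ne_zero ?_
      rw [← hz']
      refine (hasSum_congr fun n => ?_).1 hz
      have hz1 : (z - 1) ^ p = z ^ p - 1 := by rw [sub_pow_char, one_pow]
      rw [← hz1, map_pow])
  have := congrFun key (p * n)
  rwa [hinj.extend_apply, hinj.extend_apply] at this

theorem norm_coeff_le_one [IsDomain A] [IsUltrametricDist K] [NormOneClass A]
    (p : ℕ) [Fact p.Prime] [CharP K p] [CharP A p] (h : IsLocalAnalyticCharacter χ a)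
    (n : ℕ) : ‖a n‖ ≤ 1 := by
  obtain ⟨i, -, hi⟩ := exists_natCast_eq_of_pow_eq_self p (h.coeff_pow_char p n)
  rw [← hi]
  exact norm_natCast_le_one_of_normedAlgebra K i

variable [IsDomain A] [CompleteSpace A] [IsUltrametricDist K] [NormOneClass A]

theorem exists_descent (h : IsLocalAnalyticCharacter χ a) :
    ∃ ψ : K → A, IsLocalAnalyticCharacter ψ (fun m => a (p * m)) := by
  obtain ⟨c, hcp, hc⟩ := exists_natCast_eq_of_pow_eq_self p (h.coeff_pow_char p 1)
  let ψ : K → A := fun z => ∑' m, a (p * m) * algebraMap K A (z - 1) ^ m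
  have hψ : ∀ᶠ z in 𝓝 (1 : K), HasSum (fun m => a (p * m) * algebraMap K A (z - 1) ^ m) (ψ z) := by
    filter_upwards [Metric.ball_mem_nhds (1 : K) one_pos] with z hz
    exact (summable_mul_pow_of_norm_le_one (fun m => h.norm_coeff_le_one p (p * m))
      (by simpa [dist_eq_norm] using hz)).hasSum
  have hfactor : ∀ᶠ z in 𝓝 (1 : K), χ z = algebraMap K A z ^ c * ψ z ^ p := by
    filter_upwards [hψ, h.eventually_hasSum] with z hz hχ
    have h1 : HasSum (fun m => algebraMap K A z ^ c *
        (a (p * m) * algebraMap K A (z - 1) ^ (p * m))) (algebraMap K A z ^ c * ψ z ^ p) := by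
      refine HasSum.mul_left _ ?_
      refine (hasSum_congr fun m => ?_).1 (hz.map (frobenius A p) (continuous_pow p))
      rw [Function.comp_apply, frobenius_def, mul_pow, h.coeff_pow_char p, ← pow_mul, mul_comm m]
    refine HasSum.unique ?_ h1
    have : NeZero p := ⟨hp.out.ne_zero⟩
    rw [← (Nat.divModEquiv p).symm.hasSum_iff] at hχ
    refine hχ.prod_fiberwise fun m => ?_
    have hbinom : algebraMap K A z ^ c =
        ∑ i : Fin p, algebraMap K A (z - 1) ^ (i : ℕ) * (c.choose i : A) := by
      rw [Fin.sum_univ_eq_sum_range (fun i => algebraMap K A (z - 1) ^ i * (c.choose i : A)) p]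
      have hz1 : algebraMap K A z = algebraMap K A (z - 1) + 1 := by
        rw [map_sub, _root_.map_one, sub_add_cancel]
      rw [hz1, add_pow]
      simp only [one_pow, mul_one]
      refine Finset.sum_subset (Finset.range_subset_range.2 hcp) fun i _ hi => ?_
      rw [Nat.choose_eq_zero_of_lt (by simpa using hi), Nat.cast_zero, mul_zero]
    rw [hbinom, Finset.sum_mul]
    refine (hasSum_congr fun i => ?_).1 (hasSum_fintype _)
    simp only [Function.comp_apply, Nat.divModEquiv_symm_apply]
    rw [mul_comm m p, h.coeff_block p hc m i i.2, pow_add]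
    ring
  refine ⟨ψ, ?_, ?_, hψ⟩
  · have h1 := hψ.self_of_nhds
    rw [sub_self, _root_.map_zero] at h1
    rw [eq_coeff_zero_of_hasSum h1, mul_zero, h.coeff_zero]
  · have ht1 : Tendsto (fun q : K × K => q.1) (𝓝 (1, 1)) (𝓝 1) := continuous_fst.tendsto _
    have ht2 : Tendsto (fun q : K × K => q.2) (𝓝 (1, 1)) (𝓝 1) := continuous_snd.tendsto _
    have ht : Tendsto (fun q : K × K => q.1 * q.2) (𝓝 (1, 1)) (𝓝 1) := by
      simpa using ht1.mul ht2
    filter_upwards [h.eventually_map_mul, ht1.eventually hfactor, ht2.eventually hfactor,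
      ht.eventually hfactor, ht.eventually_ne one_ne_zero] with q hq h1 h2 h12 hne
    rw [h1, h2, h12] at hq
    have hne' : algebraMap K A (q.1 * q.2) ^ c ≠ 0 :=
      pow_ne_zero _ ((map_ne_zero_iff _ (algebraMap K A).injective).2 hne)
    refine frobenius_inj A p (mul_left_cancel₀ hne' ?_)
    rw [frobenius_def, frobenius_def, hq, map_mul]
    ring

theorem exists_forall_coeff_eq_choose (k : ℕ) :
    ∀ {χ : K → A} {a : ℕ → A}, IsLocalAnalyticCharacter χ a →
      ∃ r : ℕ, ∀ n < p ^ k, a n = r.choose n := by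
  induction k with
  | zero =>
    intro χ a h
    refine ⟨0, fun n hn => ?_⟩
    obtain rfl : n = 0 := by simpa using hn
    simpa using h.coeff_zero
  | succ k ih =>
    intro χ a h
    obtain ⟨ψ, hψ⟩ := h.exists_descent p
    obtain ⟨r, hr⟩ := ih hψ
    obtain ⟨c, hcp, hc⟩ := exists_natCast_eq_of_pow_eq_self p (h.coeff_pow_char p 1)
    exact ⟨c + p * r, fun n hn => h.coeff_eq_mul_choose p hcp hc
      (hr _ (Nat.div_lt_of_lt_mul (by rwa [pow_succ'] at hn)))⟩

theorem exists_padicInt_coeff_eq_choose (h : IsLocalAnalyticCharacter χ a) :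
    ∃ c : ℤ_[p], ∀ n, a n = (c.appr (n + 1)).choose n := by
  choose r hr using fun k => exists_forall_coeff_eq_choose p k h
  obtain ⟨c, hc⟩ := PadicInt.exists_forall_modEq_appr (p := p) (r := r) fun k =>
    modEq_of_forall_natCast_choose_eq (A := A) p fun n hn => by
      rw [← hr _ n hn, ← hr _ n (hn.trans_le (Nat.pow_le_pow_right hp.out.pos k.le_succ))]
  refine ⟨c, fun n => ?_⟩
  have hn : n < p ^ (n + 1) := n.lt_succ_self.trans (Nat.lt_pow_self hp.out.one_lt)
  rw [hr _ n hn, natCast_choose_eq_of_modEq p (hc (n + 1)) hn]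

end IsLocalAnalyticCharacter

end LocalCharacter

theorem PadicInt.eq_of_forall_natCast_choose_appr_eq {A : Type*} [CommRing A] [Nontrivial A]
    {p : ℕ} [hp : Fact p.Prime] [CharP A p] {c d : ℤ_[p]}
    (h : ∀ n, ((c.appr (n + 1)).choose n : A) = (d.appr (n + 1)).choose n) : c = d := by
  have hstable (x : ℤ_[p]) {k n : ℕ} (hn : n < p ^ k) :
      ((x.appr k).choose n : A) = (x.appr (n + 1)).choose n := by
    have hn' : n < p ^ (n + 1) := n.lt_succ_self.trans (Nat.lt_pow_self hp.out.one_lt)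
    have happr {i j : ℕ} (hij : i ≤ j) : x.appr i ≡ x.appr j [MOD p ^ i] :=
      (Nat.modEq_iff_dvd' (x.appr_mono hij)).2 (x.dvd_appr_sub_appr i j hij)
    rcases le_total k (n + 1) with hk | hk
    · exact natCast_choose_eq_of_modEq p (happr hk) hn
    · exact (natCast_choose_eq_of_modEq p (happr hk) hn').symm
  refine PadicInt.ext_of_toZModPow.1 fun k => ?_
  change ((c.appr k : ℕ) : ZMod (p ^ k)) = (d.appr k : ℕ)
  refine (ZMod.natCast_eq_natCast_iff _ _ _).2 (modEq_of_forall_natCast_choose_eq (A := A) p ?_)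
  intro n hn
  rw [hstable c hn, hstable d hn, h n]

/-- **Locally analytic characters of the one-units in characteristic `p`.**
Every multiplicative character of the group `U = {z : ‖z - 1‖ < 1}` of a complete
nonarchimedean field `K` of characteristic `p`, with values in a nonarchimedean Banach
`K`-algebra `A` which is an integral domain, that is analytic at every point of `U`,
is of the form `z ↦ z ^ c = ∑ binom (c, n) (z - 1) ^ n` for a unique `c ∈ ℤ_p`;
in particular it takes values in the one-units of `A`. -/
theorem locally_analytic_character_char_p
    (p : ℕ) [Fact p.Prime]
    (K : Type*) [NontriviallyNormedField K] [CompleteSpace K] [IsUltrametricDist K]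
    [CharP K p]
    (A : Type*) [NormedCommRing A] [NormOneClass A] [NormedAlgebra K A] [CompleteSpace A]
    [IsUltrametricDist A] [IsDomain A]
    (χ : K → A)
    (hone : χ 1 = 1)
    (hmul : ∀ z w : K, ‖z - 1‖ < 1 → ‖w - 1‖ < 1 → χ (z * w) = χ z * χ w)
    (hanal : ∀ z : K, ‖z - 1‖ < 1 → AnalyticAt K χ z) :
    (∃! c : ℤ_[p], ∀ z : K, ‖z - 1‖ < 1 →
        HasSum
          (fun n : ℕ => ((PadicInt.appr c (n + 1)).choose n : A) * (algebraMap K A (z - 1)) ^ n)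
          (χ z)) ∧
      ∀ z : K, ‖z - 1‖ < 1 → ‖χ z - 1‖ < 1 := by
  have hpp : p.Prime := Fact.out
  have : CharP A p := charP_of_injective_algebraMap (algebraMap K A).injective p
  have hball : ∀ᶠ z in 𝓝 (1 : K), ‖z - 1‖ < 1 := by
    filter_upwards [Metric.ball_mem_nhds (1 : K) one_pos] with z hz
    simpa [dist_eq_norm] using hz
  obtain ⟨P, hP⟩ := hanal 1 (by simp)
  have hloc : IsLocalAnalyticCharacter χ P.coeff := by
    refine ⟨hone, ?_, ?_⟩
    · filter_upwards [(continuous_fst.tendsto ((1 : K), (1 : K))).eventually hball,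
        (continuous_snd.tendsto ((1 : K), (1 : K))).eventually hball] with q h1 h2
      exact hmul _ _ h1 h2
    · filter_upwards [hasFPowerSeriesAt_iff'.1 hP] with z hz
      refine (hasSum_congr fun n => ?_).1 hz
      rw [Algebra.smul_def, map_pow, mul_comm]
  obtain ⟨c, hc⟩ := hloc.exists_padicInt_coeff_eq_choose p
  have hsum : ∀ z : K, ‖z - 1‖ < 1 →
      HasSum (fun n : ℕ => ((c.appr (n + 1)).choose n : A) * (algebraMap K A (z - 1)) ^ n)
        (χ z) := by
    intro z hz
    obtain ⟨s, hs⟩ := summable_mul_pow_of_norm_le_one (K := K)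
      (fun n => norm_natCast_le_one_of_normedAlgebra K (A := A) ((c.appr (n + 1)).choose n)) hz
    have hpow (m : ℕ) : ‖z ^ m - 1‖ < 1 ∧ χ (z ^ m) = χ z ^ m := by
      induction m with
      | zero => simp [hone]
      | succ m ih =>
        have hsub : z ^ (m + 1) - 1 = (z ^ m - 1) * (z - 1) + (z ^ m - 1) + (z - 1) := by ring
        refine ⟨?_, by rw [pow_succ, hmul _ _ ih.1 hz, ih.2, pow_succ]⟩
        rw [hsub]
        refine (IsUltrametricDist.norm_add_le_max _ _).trans_lt (max_lt ?_ hz)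
        refine (IsUltrametricDist.norm_add_le_max _ _).trans_lt (max_lt ?_ ih.1)
        rw [norm_mul]
        exact mul_lt_one_of_nonneg_of_lt_one_left (norm_nonneg _) ih.1 hz.le
    have hlim : Tendsto (fun k : ℕ => z ^ p ^ k) atTop (𝓝 1) := by
      rw [tendsto_iff_norm_sub_tendsto_zero]
      have : (fun k : ℕ => ‖z ^ p ^ k - 1‖) = fun k => ‖z - 1‖ ^ p ^ k := by
        funext k
        rw [← norm_pow, sub_pow_char_pow, one_pow]
      rw [this]
      exact (tendsto_pow_atTop_nhds_zero_of_lt_one (norm_nonneg _) hz).comp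
        (tendsto_pow_atTop_atTop_of_one_lt hpp.one_lt)
    obtain ⟨k, hk⟩ := (hlim.eventually hloc.eventually_hasSum).exists
    have hs' := hs.map (iterateFrobenius A p k) (continuous_pow (p ^ k))
    have heq : χ z ^ p ^ k = s ^ p ^ k := by
      rw [← (hpow (p ^ k)).2]
      refine hk.unique ((hasSum_congr fun n => ?_).1 hs')
      rw [Function.comp_apply, map_mul, map_natCast, hc n, iterateFrobenius_def, pow_right_comm,
        ← map_pow, sub_pow_char_pow, one_pow]
    have : χ z = s := iterateFrobenius_inj A p k heq
    rwa [this]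
  refine ⟨⟨c, hsum, fun d hd => ?_⟩, fun z hz => ?_⟩
  · refine PadicInt.eq_of_forall_natCast_choose_appr_eq (A := A) fun n => ?_
    exact congrFun (coeff_eq_of_eventually_hasSum (z₀ := (1 : K)) (hball.mono hd)
      (hball.mono hsum)) n
  · have htail := (hasSum_nat_add_iff' 1).2 (hsum z hz)
    simp only [Finset.range_one, Finset.sum_singleton, Nat.choose_zero_right, Nat.cast_one,
      pow_zero, mul_one] at htail
    rw [← htail.tsum_eq]
    refine (IsUltrametricDist.norm_tsum_le_of_forall_le_of_nonneg (norm_nonneg (z - 1))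
      fun n => ?_).trans_lt hz
    refine (norm_mul_le _ _).trans ?_
    rw [← map_pow, norm_algebraMap', norm_pow, pow_succ]
    refine (mul_le_of_le_one_left (by positivity)
      (norm_natCast_le_one_of_normedAlgebra K _)).trans ?_
    exact mul_le_of_le_one_left (norm_nonneg _) (pow_le_one₀ (norm_nonneg _) hz.le)
end

section
/- Let p be a prime and let K be a field of characteristic p that is complete with respect to a nontrivial nonarchimedean absolute value ‖·‖, and let U = {z ∈ K : ‖z−1‖ < 1}. Then for every c ∈ ℤ_p and every z ∈ U the series ∑_{n≥0} binom(c,n)·(z−1)^n, with coefficients the reduced binomial coefficients in the prime field F_p ⊆ K, converges in K (HasSum); writing z^c for its sum, one has ‖z^c − 1‖ < 1 (so z^c ∈ U), and (z·w)^c = z^c · w^c for all z, w ∈ U. In other words, for each c ∈ ℤ_p the map z ↦ z^c is a character of the multiplicative group U into itself. -/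
/-- For `c ∈ ℤ_p` and `z` in a field of characteristic `p`, the power `z ^ c` is defined as
the sum of the series `∑ binom (c, n) (z - 1) ^ n`, where `binom (c, n)` is the reduced
binomial coefficient in the prime field `𝔽_p ⊆ K`, realized as
`Nat.choose (PadicInt.appr c (n+1)) n` cast into `K`. -/
noncomputable def padicPow (p : ℕ) [Fact p.Prime] {K : Type*} [NormedField K]
    (c : ℤ_[p]) (z : K) : K :=
  ∑' n : ℕ, ((PadicInt.appr c (n + 1)).choose n : K) * (z - 1) ^ n

/-- Binomial coefficients `a.choose n` with `n < p ^ k` depend, modulo `p`, only on `a` modulo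
`p ^ k`. -/
theorem Nat.ModEq.choose_modEq_of_lt_prime_pow {p : ℕ} [Fact p.Prime] {k a b n : ℕ}
    (h : a ≡ b [MOD p ^ k]) (hn : n < p ^ k) : a.choose n ≡ b.choose n [MOD p] := by
  induction k generalizing a b n with
  | zero =>
    obtain rfl : n = 0 := by simpa using hn
    simp [Nat.ModEq]
  | succ k ih =>
    have hmod : a % p = b % p := h.of_dvd (dvd_pow_self p k.succ_ne_zero)
    have hdiv : a / p ≡ b / p [MOD p ^ k] := by
      have h' : a % (p * p ^ k) = b % (p * p ^ k) := by rw [← pow_succ']; exact h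
      have := congrArg (· / p) h'
      simpa only [Nat.mod_mul_right_div_self, Nat.ModEq] using this
    have hlt : n / p < p ^ k := Nat.div_lt_of_lt_mul (by rwa [← pow_succ'])
    calc a.choose n
        ≡ (a % p).choose (n % p) * (a / p).choose (n / p) [MOD p] :=
          Choose.choose_modEq_choose_mod_mul_choose_div_nat
      _ ≡ (b % p).choose (n % p) * (b / p).choose (n / p) [MOD p] := by
          rw [hmod]; exact (ih hdiv hlt).mul_left _
      _ ≡ b.choose n [MOD p] := Choose.choose_modEq_choose_mod_mul_choose_div_nat.symm

theorem PadicInt.appr_modEq_appr {p : ℕ} [Fact p.Prime] (c : ℤ_[p]) {m n : ℕ} (h : m ≤ n) :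
    c.appr m ≡ c.appr n [MOD p ^ m] :=
  (Nat.modEq_iff_dvd' (c.appr_mono h)).2 (c.dvd_appr_sub_appr m n h)

theorem norm_natCast_mul_pow_le {K : Type*} [NormedField K] [IsUltrametricDist K]
    (a : ℕ) (x : K) (n : ℕ) : ‖(a : K) * x ^ n‖ ≤ ‖x‖ ^ n := by
  rw [norm_mul, norm_pow]
  exact mul_le_of_le_one_left (by positivity) (IsUltrametricDist.norm_natCast_le_one K a)

theorem norm_mul_sub_one_lt_one {K : Type*} [NormedField K] [IsUltrametricDist K] {z w : K}
    (hz : ‖z - 1‖ < 1) (hw : ‖w - 1‖ < 1) : ‖z * w - 1‖ < 1 := by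
  have hz' : ‖z‖ ≤ 1 := by
    simpa [hz.le] using IsUltrametricDist.norm_add_le_max (z - 1) 1
  have h : z * w - 1 = z * (w - 1) + (z - 1) := by ring
  rw [h]
  refine (IsUltrametricDist.norm_add_le_max _ _).trans_lt (max_lt ?_ hz)
  rw [norm_mul]
  exact (mul_le_of_le_one_left (norm_nonneg _) hz').trans_lt hw

theorem norm_pow_sub_one_lt_one {K : Type*} [NormedField K] [IsUltrametricDist K] {z : K}
    (hz : ‖z - 1‖ < 1) (n : ℕ) : ‖z ^ n - 1‖ < 1 := by
  induction n with
  | zero => simp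
  | succ n ih => rw [pow_succ]; exact norm_mul_sub_one_lt_one ih hz

theorem tsum_choose_mul_sub_one_pow {K : Type*} [NormedField K] (a : ℕ) (z : K) :
    ∑' n : ℕ, (a.choose n : K) * (z - 1) ^ n = z ^ a := by
  rw [tsum_eq_sum (s := Finset.range (a + 1))]
  · conv_rhs => rw [← sub_add_cancel z 1, add_pow]
    exact Finset.sum_congr rfl fun n _ => by rw [one_pow, mul_one, mul_comm]
  · intro n hn
    rw [Nat.choose_eq_zero_of_lt (by simpa [Nat.succ_le_iff] using hn), Nat.cast_zero, zero_mul]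

/-- The `p`-adic power `z ^ c` is the limit of the powers `z ^ m` with `m` running through the
natural approximations of `c`. -/
theorem tendsto_pow_appr_padicPow {p : ℕ} [Fact p.Prime] {K : Type*} [NormedField K]
    [CompleteSpace K] [IsUltrametricDist K] [CharP K p] (c : ℤ_[p]) {z : K} (hz : ‖z - 1‖ < 1) :
    Filter.Tendsto (fun m => z ^ c.appr m) Filter.atTop (nhds (padicPow p c z)) := by
  refine Filter.Tendsto.congr (fun m => tsum_choose_mul_sub_one_pow (c.appr m) z) ?_
  refine tendsto_tsum_of_dominated_convergence
    (summable_geometric_of_lt_one (norm_nonneg (z - 1)) hz) (fun n => ?_)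
    (Filter.Eventually.of_forall fun m n => norm_natCast_mul_pow_le _ _ n)
  refine tendsto_const_nhds.congr' ?_
  filter_upwards [Filter.eventually_ge_atTop (n + 1)] with m hm
  have hlt : n < p ^ (n + 1) :=
    n.lt_succ_self.trans (Nat.lt_pow_self (Fact.out : p.Prime).one_lt)
  rw [(CharP.natCast_eq_natCast K p).2
    ((c.appr_modEq_appr hm).choose_modEq_of_lt_prime_pow hlt)]

/-- **`ℤ_p`-powers of one-units in characteristic `p`.**  For every `c ∈ ℤ_p` and every `z`
with `‖z - 1‖ < 1` in a complete nonarchimedean field `K` of characteristic `p`, the series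
`∑ binom (c, n) (z - 1) ^ n` converges, its sum `z ^ c` again satisfies `‖z ^ c - 1‖ < 1`,
and `(z * w) ^ c = z ^ c * w ^ c` for all one-units `z, w`; i.e. `z ↦ z ^ c` is a character
of the group of one-units. -/
theorem padicPow_hasSum_mem_and_mul
    (p : ℕ) [Fact p.Prime]
    (K : Type*) [NontriviallyNormedField K] [CompleteSpace K] [IsUltrametricDist K]
    [CharP K p]
    (c : ℤ_[p]) (z : K) (hz : ‖z - 1‖ < 1) :
    HasSum (fun n : ℕ => ((PadicInt.appr c (n + 1)).choose n : K) * (z - 1) ^ n)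
        (padicPow p c z) ∧
      ‖padicPow p c z - 1‖ < 1 ∧
      ∀ w : K, ‖w - 1‖ < 1 → padicPow p c (z * w) = padicPow p c z * padicPow p c w := by
  refine ⟨?_, ?_, fun w hw => ?_⟩
  · exact (Summable.of_norm_bounded (summable_geometric_of_lt_one (norm_nonneg (z - 1)) hz)
      fun n => norm_natCast_mul_pow_le _ _ n).hasSum
  · have hmem : padicPow p c z ∈ Metric.ball (1 : K) 1 :=
      (IsUltrametricDist.isClosed_ball 1 1).mem_of_tendsto (tendsto_pow_appr_padicPow c hz)
        (Filter.Eventually.of_forall fun m =>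
          mem_ball_iff_norm.2 (norm_pow_sub_one_lt_one hz _))
    exact mem_ball_iff_norm.1 hmem
  · refine tendsto_nhds_unique (tendsto_pow_appr_padicPow c (norm_mul_sub_one_lt_one hz hw)) ?_
    simpa only [mul_pow] using
      (tendsto_pow_appr_padicPow c hz).mul (tendsto_pow_appr_padicPow c hw)
end

section
/- Let p be a prime, let I and J be countable index sets, and let E := ∏_{x∈I} ℤ_p and F := ∏_{y∈J} ℤ_p carry the product topologies. Then the map sending a continuous additive group homomorphism χ : E → F to the family ((pr_y ∘ χ)(δ_x))_{y∈J, x∈I} is a group isomorphism and a homeomorphism from Hom_cts(E, F), equipped with the compact-open topology, onto the product ∏_{y∈J} c₀(I, ℤ_p), where c₀(I, ℤ_p) denotes the group of families I → ℤ_p tending to 0 along the cofinite filter, equipped with the supremum-norm topology, and the product carries the product topology. -/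
open Filter Topology ZeroAtInfty

section CharacterSeries

variable {p : ℕ} [Fact p.Prime] {I : Type*} [TopologicalSpace I] [DiscreteTopology I]

lemma hasSum_smul_eval (c : C₀(I, ℤ_[p])) :
    HasSum (fun x ↦ c x • (ContinuousMap.eval x : C(I → ℤ_[p], ℤ_[p])))
      (∑' x, c x • (ContinuousMap.eval x : C(I → ℤ_[p], ℤ_[p]))) := by
  refine (NonarchimedeanAddGroup.summable_of_tendsto_cofinite_zero ?_).hasSum
  have hc : Tendsto c cofinite (𝓝 0) := cocompact_eq_cofinite I ▸ zero_at_infty c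
  refine squeeze_zero_norm (fun x ↦ ?_) (tendsto_zero_iff_norm_tendsto_zero.1 hc)
  refine (ContinuousMap.norm_le _ (norm_nonneg (c x))).2 fun a ↦ ?_
  simpa using mul_le_of_le_one_right (norm_nonneg (c x)) (PadicInt.norm_le_one (a x))

/-- The continuous function `a ↦ ∑' x, c x * a x` on `I → ℤ_[p]` attached to `c : C₀(I, ℤ_[p])`,
as an additive function of `c`. -/
noncomputable def characterSeries : C₀(I, ℤ_[p]) →+ C(I → ℤ_[p], ℤ_[p]) :=
  AddMonoidHom.mk' (fun c ↦ ∑' x, c x • (ContinuousMap.eval x : C(I → ℤ_[p], ℤ_[p])))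
    fun c d ↦ by
      rw [← ((hasSum_smul_eval c).add (hasSum_smul_eval d)).tsum_eq]
      simp only [ZeroAtInftyContinuousMap.add_apply, add_smul]

lemma hasSum_characterSeries (c : C₀(I, ℤ_[p])) (a : I → ℤ_[p]) :
    HasSum (fun x ↦ c x * a x) (characterSeries c a) :=
  (hasSum_smul_eval c).map (ContinuousMap.evalCLM ℤ_[p] a) (ContinuousMap.evalCLM ℤ_[p] a).continuous

lemma characterSeries_single [DecidableEq I] (c : C₀(I, ℤ_[p])) (x : I) :
    characterSeries c (Pi.single x 1) = c x := by
  refine (hasSum_characterSeries c _).unique ?_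
  convert hasSum_single x fun y hy ↦ ?_ using 1 <;> simp_all

lemma norm_characterSeries (c : C₀(I, ℤ_[p])) : ‖characterSeries c‖ = ‖c‖ := by
  classical
  rw [← ZeroAtInftyContinuousMap.norm_toBCF_eq_norm]
  refine le_antisymm ((ContinuousMap.norm_le _ (norm_nonneg _)).2 fun a ↦ ?_)
    ((BoundedContinuousFunction.norm_le (norm_nonneg _)).2 fun x ↦ ?_)
  · rw [← (hasSum_characterSeries c a).tsum_eq]
    refine IsUltrametricDist.norm_tsum_le_of_forall_le_of_nonneg (norm_nonneg _) fun x ↦ ?_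
    rw [norm_mul]
    exact (mul_le_of_le_one_right (norm_nonneg _) (PadicInt.norm_le_one _)).trans
      (c.toBCF.norm_coe_le_norm x)
  · change ‖c x‖ ≤ _
    rw [← characterSeries_single c x]
    exact (characterSeries c).norm_coe_le_norm _

lemma isometry_characterSeries :
    Isometry (characterSeries : C₀(I, ℤ_[p]) →+ C(I → ℤ_[p], ℤ_[p])) :=
  AddMonoidHomClass.isometry_of_norm _ norm_characterSeries

/-- The continuous character `a ↦ ∑' x, c x * a x` of `I → ℤ_[p]`. -/
noncomputable def characterOfZeroAtInfty (c : C₀(I, ℤ_[p])) :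
    ContinuousAddMonoidHom (I → ℤ_[p]) ℤ_[p] where
  toAddMonoidHom := AddMonoidHom.mk' (characterSeries c) fun a b ↦
    (hasSum_characterSeries c (a + b)).unique <| by
      simpa only [Pi.add_apply, mul_add] using
        (hasSum_characterSeries c a).add (hasSum_characterSeries c b)
  continuous_toFun := (characterSeries c).continuous

lemma PadicInt.map_mul_of_continuous {f : ℤ_[p] →+ ℤ_[p]} (hf : Continuous f) (a : ℤ_[p]) :
    f a = f 1 * a :=
  congrFun (PadicInt.denseRange_intCast.equalizer hf (continuous_const_mul (f 1)) <| by
    ext1 n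
    simpa [mul_comm] using map_zsmul f n 1) a

/-- The values of a continuous character on the standard basis vectors. -/
noncomputable def zeroAtInftyOfCharacter [DecidableEq I] (χ : ContinuousAddMonoidHom (I → ℤ_[p]) ℤ_[p]) :
    C₀(I, ℤ_[p]) where
  toFun x := χ (Pi.single x 1)
  continuous_toFun := continuous_of_discreteTopology
  zero_at_infty' := by
    rw [cocompact_eq_cofinite, ← map_zero χ]
    refine (χ.continuous_toFun.tendsto 0).comp (tendsto_pi_nhds.2 fun y ↦ ?_)
    refine tendsto_const_nhds.congr' ?_
    filter_upwards [(Set.finite_singleton y).compl_mem_cofinite] with x hx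
    exact (Pi.single_eq_of_ne (M := fun _ ↦ ℤ_[p]) (Ne.symm hx) 1).symm

lemma characterSeries_zeroAtInftyOfCharacter [DecidableEq I]
    (χ : ContinuousAddMonoidHom (I → ℤ_[p]) ℤ_[p]) (a : I → ℤ_[p]) :
    characterSeries (zeroAtInftyOfCharacter χ) a = χ a := by
  refine (hasSum_characterSeries _ a).unique ?_
  have ha : HasSum (fun x ↦ Pi.single x (a x)) a := Pi.hasSum.2 fun y ↦ by
    convert hasSum_single y fun x hx ↦ ?_ using 1
    · simp
    · exact Pi.single_eq_of_ne (Ne.symm hx) _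
  convert ha.map χ χ.continuous_toFun using 1
  ext1 x
  exact (PadicInt.map_mul_of_continuous
    (f := (χ : (I → ℤ_[p]) →+ ℤ_[p]).comp (AddMonoidHom.single (fun _ ↦ ℤ_[p]) x))
    (χ.continuous_toFun.comp (continuous_single (A := fun _ ↦ ℤ_[p]) x)) (a x)).symm

end CharacterSeries


/-- **Continuous characters of countable products of `ℤ_p` (Proposition A2).**
For countable index sets `I`, `J` (with `I` discrete), the map sending a continuous
additive group homomorphism `χ : ∏_{x ∈ I} ℤ_p → ∏_{y ∈ J} ℤ_p` to the family
`((pr_y ∘ χ)(δ_x))_{y ∈ J, x ∈ I}` is a group isomorphism and a homeomorphism from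
`Hom_cts(∏_I ℤ_p, ∏_J ℤ_p)` with the compact-open topology onto `∏_{y ∈ J} c₀(I, ℤ_p)`,
where `c₀(I, ℤ_p)` is the space of families vanishing at infinity with the supremum-norm
topology and the product carries the product topology. -/
theorem continuous_characters_of_products
    (p : ℕ) [Fact p.Prime]
    (I J : Type*) [Countable I] [Countable J] [DecidableEq I]
    [TopologicalSpace I] [DiscreteTopology I] :
    ∃ e : ContinuousAddMonoidHom (I → ℤ_[p]) (J → ℤ_[p]) ≃
        (J → ZeroAtInftyContinuousMap I ℤ_[p]),
      (∀ (χ : ContinuousAddMonoidHom (I → ℤ_[p]) (J → ℤ_[p])) (y : J) (x : I),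
          e χ y x = χ (Pi.single x 1) y) ∧
      (∀ χ χ' : ContinuousAddMonoidHom (I → ℤ_[p]) (J → ℤ_[p]),
          e (χ + χ') = e χ + e χ') ∧
      IsHomeomorph e := by
  let proj (χ : ContinuousAddMonoidHom (I → ℤ_[p]) (J → ℤ_[p])) (y : J) :
      ContinuousAddMonoidHom (I → ℤ_[p]) ℤ_[p] :=
    { toAddMonoidHom := (Pi.evalAddMonoidHom _ y).comp (χ : (I → ℤ_[p]) →+ (J → ℤ_[p]))
      continuous_toFun := (continuous_apply y).comp χ.continuous_toFun }
  let e : ContinuousAddMonoidHom (I → ℤ_[p]) (J → ℤ_[p]) ≃ (J → C₀(I, ℤ_[p])) :=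
    { toFun := fun χ y ↦ zeroAtInftyOfCharacter (proj χ y)
      invFun := fun c ↦
        { toAddMonoidHom := AddMonoidHom.mk' (fun a y ↦ characterOfZeroAtInfty (c y) a)
            fun a b ↦ funext fun y ↦ map_add (characterOfZeroAtInfty (c y)) a b
          continuous_toFun := continuous_pi fun y ↦
            (characterOfZeroAtInfty (c y)).continuous_toFun }
      left_inv := fun χ ↦ ContinuousAddMonoidHom.ext fun a ↦ funext fun y ↦
        characterSeries_zeroAtInftyOfCharacter (proj χ y) a
      right_inv := fun c ↦ funext fun y ↦ ZeroAtInftyContinuousMap.ext fun x ↦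
        characterSeries_single (c y) x }
  refine ⟨e, fun _ _ _ ↦ rfl, fun _ _ ↦ rfl, e.isHomeomorph_iff.2 ⟨?_, ?_⟩⟩
  · refine continuous_pi fun y ↦
      isometry_characterSeries.isUniformInducing.isInducing.continuous_iff.2 ?_
    have hy : Continuous fun χ : ContinuousAddMonoidHom (I → ℤ_[p]) (J → ℤ_[p]) ↦
        (ContinuousMap.eval y : C(J → ℤ_[p], ℤ_[p])).comp χ.toContinuousMap :=
      (ContinuousMap.continuous_postcomp _).comp
        (ContinuousAddMonoidHom.isInducing_toContinuousMap _ _).continuous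
    exact hy.congr fun χ ↦ ContinuousMap.ext fun a ↦
      (characterSeries_zeroAtInftyOfCharacter (proj χ y) a).symm
  · refine ContinuousAddMonoidHom.continuous_of_continuous_uncurry _ (continuous_pi fun y ↦ ?_)
    exact (isometry_characterSeries.continuous.comp
      ((continuous_apply y).comp continuous_fst)).eval continuous_snd
end

section
/- Let p be a prime and I a countable index set; give E := ∏_{x∈I} ℤ_p the product topology, and for x ∈ I let δ_x ∈ E be the x-th standard basis vector (Pi.single x 1). (a) For every continuous additive group homomorphism χ : E → ℤ_p, the family λ_x := χ(δ_x) tends to 0 along the cofinite filter on I, and for every a ∈ E one has χ(a) = ∑'_{x∈I} a_x·λ_x, an unconditionally convergent sum in ℤ_p. (b) Conversely, for every family λ : I → ℤ_p tending to 0 along the cofinite filter, the map a ↦ ∑'_{x∈I} a_x·λ_x is a well-defined continuous additive group homomorphism E → ℤ_p. (c) These two assignments are mutually inverse bijections, and the bijection is isometric for the supremum metrics: for continuous homomorphisms χ, χ' one has sup_{a∈E} |χ(a) − χ'(a)|_p = sup_{x∈I} |χ(δ_x) − χ'(δ_x)|_p. -/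
open Filter

namespace PadicInt

variable {p : ℕ} [Fact p.Prime] {I : Type*}

theorem map_eq_mul_map_one_of_continuous (f : ℤ_[p] →+ ℤ_[p]) (hf : Continuous f) (a : ℤ_[p]) :
    f a = a * f 1 := by
  have h : (f : ℤ_[p] → ℤ_[p]) = fun a => a * f 1 :=
    denseRange_natCast.equalizer hf (by fun_prop) <| by
      ext n : 1
      simpa using map_nsmul f n 1
  exact congrFun h a

theorem hasSum_mul_map_single [DecidableEq I] (χ : ContinuousAddMonoidHom (I → ℤ_[p]) ℤ_[p])
    (a : I → ℤ_[p]) : HasSum (fun x => a x * χ (Pi.single x 1)) (χ a) := by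
  have ha : HasSum (fun x => Pi.single x (a x)) a := by
    refine Pi.hasSum.2 fun y => ?_
    convert hasSum_single (f := fun x => (Pi.single x (a x) : I → ℤ_[p]) y) y
      (fun x hx => Pi.single_eq_of_ne hx.symm _) using 1
    simp
  convert ha.map χ χ.continuous_toFun using 1
  ext x : 1
  exact (map_eq_mul_map_one_of_continuous
    (χ.toAddMonoidHom.comp (AddMonoidHom.single (fun _ : I => ℤ_[p]) x))
    (χ.continuous_toFun.comp (continuous_single (A := fun _ : I => ℤ_[p]) x)) (a x)).symm

theorem norm_le_of_hasSum {f : I → ℤ_[p]} {s : ℤ_[p]} {C : ℝ} (hC : 0 ≤ C) (hf : HasSum f s)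
    (h : ∀ x, ‖f x‖ ≤ C) : ‖s‖ ≤ C :=
  le_of_tendsto hf.norm <| Eventually.of_forall fun _ =>
    IsUltrametricDist.norm_sum_le_of_forall_le_of_nonneg hC fun x _ => h x

theorem tendsto_cofinite_map_single [DecidableEq I]
    (χ : ContinuousAddMonoidHom (I → ℤ_[p]) ℤ_[p]) :
    Tendsto (fun x => χ (Pi.single x 1)) cofinite (nhds 0) := by
  simpa using (hasSum_mul_map_single χ 1).summable.tendsto_cofinite_zero

theorem summable_mul_of_tendsto_cofinite {lam : I → ℤ_[p]}
    (hlam : Tendsto lam cofinite (nhds 0)) (a : I → ℤ_[p]) : Summable fun x => a x * lam x := by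
  refine NonarchimedeanAddGroup.summable_of_tendsto_cofinite_zero ?_
  refine squeeze_zero_norm (fun x => ?_) (tendsto_zero_iff_norm_tendsto_zero.1 hlam)
  rw [norm_mul]
  exact mul_le_of_le_one_left (norm_nonneg _) (norm_le_one _)

/-- The additive homomorphism `a ↦ ∑' x, a x * lam x` attached to a family `lam` tending
to `0`. -/
noncomputable def tsumMulHom (lam : I → ℤ_[p]) (hlam : Tendsto lam cofinite (nhds 0)) :
    (I → ℤ_[p]) →+ ℤ_[p] :=
  AddMonoidHom.mk' (fun a => ∑' x, a x * lam x) fun a b => by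
    simp only [Pi.add_apply, add_mul]
    exact (summable_mul_of_tendsto_cofinite hlam a).tsum_add
      (summable_mul_of_tendsto_cofinite hlam b)

/-- The continuous character `a ↦ ∑' x, a x * lam x` attached to a family `lam` tending to `0`. -/
noncomputable def characterOfTendstoZero (lam : I → ℤ_[p])
    (hlam : Tendsto lam cofinite (nhds 0)) : ContinuousAddMonoidHom (I → ℤ_[p]) ℤ_[p] where
  toAddMonoidHom := tsumMulHom lam hlam
  continuous_toFun := by
    refine continuous_of_continuousAt_zero (tsumMulHom lam hlam) ?_
    rw [ContinuousAt, map_zero, Metric.nhds_basis_closedBall.tendsto_right_iff]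
    intro ε hε
    have hfin : {x | ¬ ‖lam x‖ ≤ ε}.Finite := by
      simpa using hlam.eventually (Metric.closedBall_mem_nhds 0 hε)
    have hsmall : ∀ᶠ a : I → ℤ_[p] in nhds 0, ∀ x ∈ {x | ¬ ‖lam x‖ ≤ ε}, ‖a x‖ ≤ ε :=
      (eventually_all_finite hfin).2 fun x _ => by
        simpa using (continuous_apply x).continuousAt.eventually
          (Metric.closedBall_mem_nhds ((0 : I → ℤ_[p]) x) hε)
    filter_upwards [hsmall] with a ha
    rw [mem_closedBall_zero_iff]
    refine norm_le_of_hasSum hε.le (summable_mul_of_tendsto_cofinite hlam a).hasSum fun x => ?_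
    rw [norm_mul]
    by_cases hx : ‖lam x‖ ≤ ε
    · exact (mul_le_of_le_one_left (norm_nonneg _) (norm_le_one _)).trans hx
    · exact (mul_le_of_le_one_right (norm_nonneg _) (norm_le_one _)).trans (ha x hx)

theorem hasSum_characterOfTendstoZero {lam : I → ℤ_[p]}
    (hlam : Tendsto lam cofinite (nhds 0)) (a : I → ℤ_[p]) :
    HasSum (fun x => a x * lam x) (characterOfTendstoZero lam hlam a) :=
  (summable_mul_of_tendsto_cofinite hlam a).hasSum

theorem characterOfTendstoZero_single [DecidableEq I] {lam : I → ℤ_[p]}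
    (hlam : Tendsto lam cofinite (nhds 0)) (x : I) :
    characterOfTendstoZero lam hlam (Pi.single x 1) = lam x := by
  refine (hasSum_characterOfTendstoZero hlam _).unique ?_
  convert hasSum_single (f := fun y => (Pi.single x 1 : I → ℤ_[p]) y * lam y) x
    (fun y hy => by simp [hy]) using 1
  simp

theorem iSup_norm_sub_eq_iSup_norm_sub_single [DecidableEq I]
    (χ χ' : ContinuousAddMonoidHom (I → ℤ_[p]) ℤ_[p]) :
    (⨆ a : I → ℤ_[p], ‖χ a - χ' a‖) = ⨆ x : I, ‖χ (Pi.single x 1) - χ' (Pi.single x 1)‖ := by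
  have hbdd : BddAbove (Set.range fun x : I => ‖χ (Pi.single x 1) - χ' (Pi.single x 1)‖) :=
    ⟨1, Set.forall_mem_range.2 fun _ => norm_le_one _⟩
  have hbdd' : BddAbove (Set.range fun a : I → ℤ_[p] => ‖χ a - χ' a‖) :=
    ⟨1, Set.forall_mem_range.2 fun _ => norm_le_one _⟩
  have hnonneg : 0 ≤ ⨆ x : I, ‖χ (Pi.single x 1) - χ' (Pi.single x 1)‖ :=
    Real.iSup_nonneg fun _ => norm_nonneg _
  apply le_antisymm
  · refine ciSup_le fun a => norm_le_of_hasSum hnonneg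
      ((hasSum_mul_map_single χ a).sub (hasSum_mul_map_single χ' a)) fun x => ?_
    rw [← mul_sub, norm_mul]
    exact (mul_le_of_le_one_left (norm_nonneg _) (norm_le_one _)).trans (le_ciSup hbdd x)
  · exact Real.iSup_le (fun x => le_ciSup hbdd' (Pi.single x 1))
      (Real.iSup_nonneg fun _ => norm_nonneg _)

end PadicInt

/-- **Continuous `ℤ_p`-valued characters of `∏_I ℤ_p` and zero-sequences.**
(a) For every continuous additive homomorphism `χ : ∏_{x ∈ I} ℤ_p → ℤ_p`, the family
`λ_x = χ(δ_x)` tends to `0` along the cofinite filter, and `χ(a) = ∑'_x a_x · λ_x`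
(an unconditionally convergent sum) for every `a`.
(b) Conversely every family `λ` tending to `0` along the cofinite filter arises this way
from a continuous additive homomorphism `a ↦ ∑'_x a_x · λ_x`.
(c) These assignments are mutually inverse bijections, and the correspondence is isometric
for the supremum metrics. -/
theorem continuous_characters_of_product_to_padicInt
    (p : ℕ) [Fact p.Prime]
    (I : Type*) [Countable I] [DecidableEq I] :
    (∀ χ : ContinuousAddMonoidHom (I → ℤ_[p]) ℤ_[p],
        Tendsto (fun x : I => χ (Pi.single x 1)) cofinite (nhds 0) ∧
        ∀ a : I → ℤ_[p], HasSum (fun x : I => a x * χ (Pi.single x 1)) (χ a)) ∧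
    (∀ lam : I → ℤ_[p], Tendsto lam cofinite (nhds 0) →
        ∃ χ : ContinuousAddMonoidHom (I → ℤ_[p]) ℤ_[p],
          ∀ a : I → ℤ_[p], HasSum (fun x : I => a x * lam x) (χ a)) ∧
    (∀ lam : I → ℤ_[p], Tendsto lam cofinite (nhds 0) →
        ∃! χ : ContinuousAddMonoidHom (I → ℤ_[p]) ℤ_[p],
          ∀ x : I, χ (Pi.single x 1) = lam x) ∧
    (∀ χ χ' : ContinuousAddMonoidHom (I → ℤ_[p]) ℤ_[p],
        (⨆ a : I → ℤ_[p], ‖χ a - χ' a‖) =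
          ⨆ x : I, ‖χ (Pi.single x 1) - χ' (Pi.single x 1)‖) := by
  refine ⟨fun χ => ⟨PadicInt.tendsto_cofinite_map_single χ, PadicInt.hasSum_mul_map_single χ⟩,
    fun lam hlam => ⟨PadicInt.characterOfTendstoZero lam hlam,
      PadicInt.hasSum_characterOfTendstoZero hlam⟩,
    fun lam hlam => ⟨PadicInt.characterOfTendstoZero lam hlam,
      PadicInt.characterOfTendstoZero_single hlam, fun χ hχ => ?_⟩,
    PadicInt.iSup_norm_sub_eq_iSup_norm_sub_single⟩
  ext a : 1
  refine (PadicInt.hasSum_mul_map_single χ a).unique ?_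
  simpa only [hχ] using PadicInt.hasSum_characterOfTendstoZero hlam a
end

section
/- Let 𝕜 be a complete nontrivially normed field (archimedean or nonarchimedean), let E, V, W be Banach spaces over 𝕜, and let B : E →L[𝕜] (V →L[𝕜] W) be a continuous linear map which is an isometric embedding, that is, the operator norm satisfies ‖B u‖ = ‖u‖ for every u ∈ E. Let m ∈ ℕ, let f : (Fin m → 𝕜) → E be a function on 𝕜^m (with the supremum norm), and let z₀ ∈ 𝕜^m. Then f is analytic at z₀ (AnalyticAt 𝕜 f z₀) if and only if for every v ∈ V the W-valued function z ↦ B (f z) v is analytic at z₀. -/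
open Filter Topology

/-- A Baire category form of the uniform boundedness principle: a bound on `‖A i v‖` for `i ∈ S N`,
with `N` depending on `v`, yields a bound on `‖A i‖` for `i ∈ S N` with a single `N`. -/
theorem ContinuousLinearMap.exists_forall_norm_le_of_pointwise
    {𝕜 V W ι : Type*} [NontriviallyNormedField 𝕜]
    [NormedAddCommGroup V] [NormedSpace 𝕜 V] [CompleteSpace V]
    [NormedAddCommGroup W] [NormedSpace 𝕜 W]
    (A : ι → V →L[𝕜] W) (S : ℕ → Set ι) (b : ℕ → ι → ℝ)
    (h : ∀ v, ∃ N, ∀ i ∈ S N, ‖A i v‖ ≤ b N i) :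
    ∃ N C, 0 ≤ C ∧ ∀ i ∈ S N, ‖A i‖ ≤ C * b N i := by
  have hclosed (N : ℕ) : IsClosed {v | ∀ i ∈ S N, ‖A i v‖ ≤ b N i} := by
    simp only [Set.ofPred_forall]
    exact isClosed_iInter fun i => isClosed_iInter fun _ =>
      isClosed_le (A i).continuous.norm continuous_const
  obtain ⟨N, v₀, hv₀⟩ := nonempty_interior_of_iUnion_of_closed hclosed
    (Set.eq_univ_of_forall fun v => Set.mem_iUnion.2 (h v))
  obtain ⟨ε, hε, hball⟩ := Metric.isOpen_iff.1 isOpen_interior v₀ hv₀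
  obtain ⟨c, hc⟩ := NormedField.exists_one_lt_norm 𝕜
  have hc₀ : 0 < ‖c‖ := one_pos.trans hc
  refine ⟨N, 2 * (‖c‖ / ε), by positivity, fun i hi => ?_⟩
  have hb : ‖A i v₀‖ ≤ b N i := interior_subset hv₀ i hi
  have hb₀ : 0 ≤ b N i := (norm_nonneg _).trans hb
  refine ContinuousLinearMap.opNorm_le_of_shell hε (by positivity) hc fun w hw hw' => ?_
  have hw₂ : ‖A i (v₀ + w)‖ ≤ b N i :=
    interior_subset (hball (by simpa [Metric.mem_ball, dist_eq_norm] using hw')) i hi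
  have hone : 1 ≤ ‖c‖ / ε * ‖w‖ := by
    rw [div_le_iff₀ hc₀] at hw
    rw [div_mul_eq_mul_div, le_div_iff₀ hε]
    linarith
  calc ‖A i w‖ = ‖A i (v₀ + w) - A i v₀‖ := by simp
    _ ≤ b N i + b N i := (norm_sub_le _ _).trans (add_le_add hw₂ hb)
    _ = 2 * b N i * 1 := by ring
    _ ≤ 2 * b N i * (‖c‖ / ε * ‖w‖) := by gcongr
    _ = 2 * (‖c‖ / ε) * b N i * ‖w‖ := by ring

section OneVariable

variable {𝕜 E V W : Type*} [NontriviallyNormedField 𝕜]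
  [NormedAddCommGroup E] [NormedSpace 𝕜 E] [CompleteSpace E]
  [NormedAddCommGroup V] [NormedSpace 𝕜 V] [CompleteSpace V]
  [NormedAddCommGroup W] [NormedSpace 𝕜 W]
  (B : E →L[𝕜] V →L[𝕜] W)

/-- If each `B (h ·) v` is Lipschitz on some punctured neighbourhood of `0`, then `h` has a limit
along the punctured neighbourhoods of `0`. -/
theorem exists_tendsto_punctured_of_weak_lipschitz (hB : ∀ u : E, ‖B u‖ = ‖u‖) (h : 𝕜 → E)
    (hh : ∀ v, ∃ K : NNReal, ∃ s ∈ 𝓝 (0 : 𝕜), LipschitzOnWith K (fun t => B (h t) v) (s \ {0})) :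
    ∃ e, Tendsto h (𝓝[≠] 0) (𝓝 e) := by
  obtain ⟨N, C, hC, hN⟩ := ContinuousLinearMap.exists_forall_norm_le_of_pointwise
    (fun q : 𝕜 × 𝕜 => B (h q.1) - B (h q.2))
    (fun N => (Metric.ball 0 (1 / ((N : ℝ) + 1)) \ {0}) ×ˢ (Metric.ball 0 (1 / ((N : ℝ) + 1)) \ {0}))
    (fun N q => N * dist q.1 q.2) fun v => by
      obtain ⟨K, s, hs, hK⟩ := hh v
      obtain ⟨r, hr, hrs⟩ := Metric.mem_nhds_iff.1 hs
      obtain ⟨N₁, hN₁⟩ := exists_nat_one_div_lt hr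
      obtain ⟨N₂, hN₂⟩ := exists_nat_ge (K : ℝ)
      refine ⟨max N₁ N₂, ?_⟩
      have hsub : Metric.ball (0 : 𝕜) (1 / (((max N₁ N₂ : ℕ) : ℝ) + 1)) ⊆ s := by
        refine (Metric.ball_subset_ball (le_trans ?_ hN₁.le)).trans hrs
        gcongr
        exact le_max_left _ _
      rintro ⟨t, u⟩ ⟨⟨ht, ht₀⟩, ⟨hu, hu₀⟩⟩
      have := hK.dist_le_mul t ⟨hsub ht, ht₀⟩ u ⟨hsub hu, hu₀⟩
      rw [dist_eq_norm (B (h t) v)] at this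
      refine (le_trans (by simp) this).trans ?_
      gcongr
      exact hN₂.trans (by exact_mod_cast le_max_right _ _)
  have hlip : LipschitzOnWith (C * N).toNNReal h (Metric.ball 0 (1 / ((N : ℝ) + 1)) \ {0}) :=
    LipschitzOnWith.of_dist_le_mul fun t ht u hu => by
      have := hN (t, u) ⟨ht, hu⟩
      rw [← map_sub, hB, ← dist_eq_norm] at this
      rwa [Real.coe_toNNReal _ (by positivity), mul_assoc]
  have hmem : Metric.ball (0 : 𝕜) (1 / ((N : ℝ) + 1)) \ {0} ∈ 𝓝[≠] (0 : 𝕜) :=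
    sdiff_mem_nhdsWithin_compl (Metric.ball_mem_nhds _ (by positivity)) _
  exact cauchy_iff_exists_le_nhds.1
    ((cauchy_nhds.mono nhdsWithin_le_nhds : Cauchy (𝓝[≠] (0 : 𝕜))).map_of_le
      hlip.uniformContinuousOn (le_principal_iff.2 hmem))

/-- The coefficients of the weak power series of a weakly analytic function of one variable are
represented by vectors. -/
theorem exists_coeff_of_weak_hasFPowerSeriesAt (hB : ∀ u : E, ‖B u‖ = ‖u‖) (n : ℕ) (h : 𝕜 → E)
    (q : V → FormalMultilinearSeries 𝕜 𝕜 W)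
    (hq : ∀ v, HasFPowerSeriesAt (fun t => B (h t) v) (q v) 0) :
    ∃ e : E, ∀ v, B e v = (q v).coeff n := by
  classical
  induction n generalizing h q with
  | zero => exact ⟨h 0, fun v => ((hq v).coeff_zero 1).symm⟩
  | succ n ih =>
    have hd (v : V) := (hq v).has_fpower_series_dslope_fslope
    have hslope (v : V) {t : 𝕜} (ht : t ≠ 0) :
        B (slope h 0 t) v = dslope (fun t => B (h t) v) 0 t := by
      rw [dslope_of_ne _ ht]
      simp [slope]
    obtain ⟨e, he⟩ := exists_tendsto_punctured_of_weak_lipschitz B hB (slope h 0) fun v => by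
      obtain ⟨K, s, hs, hK⟩ := (hd v).hasStrictFDerivAt.exists_lipschitzOnWith
      refine ⟨K, s, hs, fun t ht u hu => ?_⟩
      simp only [hslope v ht.2, hslope v hu.2]
      exact hK ht.1 hu.1
    have key (v : V) : (fun t => B (Function.update (slope h 0) 0 e t) v) =
        dslope (fun t => B (h t) v) 0 := by
      funext t
      obtain rfl | ht := eq_or_ne t 0
      · have h₁ : Tendsto (fun t => B (slope h 0 t) v) (𝓝[≠] 0) (𝓝 (B e v)) :=
          ((B.flip v).continuous.tendsto e).comp he
        have h₂ := (hd v).continuousAt.tendsto.mono_left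
          (nhdsWithin_le_nhds (a := (0 : 𝕜)) (s := {0}ᶜ))
        rw [Function.update_self]
        refine tendsto_nhds_unique h₁ (h₂.congr' ?_)
        filter_upwards [self_mem_nhdsWithin] with t ht using (hslope v ht).symm
      · rw [Function.update_of_ne ht, hslope v ht]
    obtain ⟨e', he'⟩ := ih (Function.update (slope h 0) 0 e) (fun v => (q v).fslope)
      fun v => by rw [key v]; exact hd v
    exact ⟨e', fun v => by rw [he', FormalMultilinearSeries.coeff_fslope]⟩

end OneVariable

section Monomials

/-- The unordered tuple underlying a word. -/
def Sym.ofWord {σ : Type*} {n : ℕ} (s : Fin n → σ) : Sym σ n := ⟨Finset.univ.val.map s, by simp⟩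

theorem Sym.prod_map_ofWord {σ M : Type*} [CommMonoid M] {n : ℕ} (s : Fin n → σ) (y : σ → M) :
    ((Sym.ofWord s : Multiset σ).map y).prod = ∏ i, y (s i) := by
  simp [Sym.ofWord, List.prod_ofFn]

theorem Sym.ofWord_surjective {σ : Type*} {n : ℕ} :
    Function.Surjective (Sym.ofWord : (Fin n → σ) → Sym σ n) := by
  rintro ⟨l, hl⟩
  induction l using Quotient.inductionOn with
  | h l =>
    obtain rfl : l.length = n := hl
    exact ⟨l.get, Subtype.ext (by simp [Sym.ofWord, Fin.univ_def])⟩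

theorem Sym.card_le_pow {σ : Type*} [Fintype σ] [DecidableEq σ] {n : ℕ} :
    Fintype.card (Sym σ n) ≤ Fintype.card σ ^ n :=
  (Fintype.card_le_of_surjective _ Sym.ofWord_surjective).trans_eq (by simp)

variable {𝕜 σ : Type*} [Fintype σ]

/-- Evaluations at points separate the monomials of degree `n`: some finite combination of them
extracts the coefficient of a given monomial. -/
theorem exists_finsupp_sum_eval_monomial [Field 𝕜] [Infinite 𝕜] [DecidableEq σ] {n : ℕ}
    (α : Sym σ n) :
    ∃ l : (σ → 𝕜) →₀ 𝕜, ∀ β : Sym σ n,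
      l.sum (fun x a => a * ((β : Multiset σ).map x).prod) = if β = α then 1 else 0 := by
  suffices hmem : Pi.single α 1 ∈ Submodule.span 𝕜
      (Set.range fun (x : σ → 𝕜) (β : Sym σ n) => ((β : Multiset σ).map x).prod) by
    obtain ⟨l, hl⟩ := Finsupp.mem_span_range_iff_exists_finsupp.1 hmem
    refine ⟨l, fun β => ?_⟩
    have := congrFun hl β
    simpa [Finsupp.sum, Finset.sum_apply, Pi.single_apply] using this
  by_contra hmem
  obtain ⟨φ, hφ, hker⟩ := Submodule.exists_le_ker_of_notMem hmem
  refine hφ ?_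
  have hP : ∑ β : Sym σ n, MvPolynomial.monomial (Multiset.toFinsupp (β : Multiset σ))
      (φ (Pi.single β 1)) = 0 := by
    refine MvPolynomial.funext fun x => ?_
    have hx : φ (fun β : Sym σ n => ((β : Multiset σ).map x).prod) = 0 :=
      hker (Submodule.subset_span ⟨x, rfl⟩)
    rw [LinearMap.pi_apply_eq_sum_univ] at hx
    rw [map_sum, map_zero, ← hx]
    refine Finset.sum_congr rfl fun β _ => ?_
    rw [MvPolynomial.eval_monomial, smul_eq_mul, mul_comm]
    congr 1
    · rw [Finset.prod_multiset_map_count, Finsupp.prod, Multiset.toFinsupp_support]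
      simp
    · congr 1
      ext γ
      simp [Pi.single_apply, eq_comm]
  have := congrArg (MvPolynomial.coeff (Multiset.toFinsupp (α : Multiset σ))) hP
  simpa [MvPolynomial.coeff_sum, MvPolynomial.coeff_monomial, Sym.coe_inj] using this

variable [NontriviallyNormedField 𝕜] {n : ℕ}

/-- Every monomial of degree `n` is the diagonal of a multilinear form of norm at most `1`. -/
theorem exists_multilinear_eval_monomial (α : Sym σ n) :
    ∃ μ : (σ → 𝕜) [×n]→L[𝕜] 𝕜, ‖μ‖ ≤ 1 ∧
      ∀ y : σ → 𝕜, μ (fun _ => y) = ((α : Multiset σ).map y).prod := by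
  obtain ⟨s, rfl⟩ := Sym.ofWord_surjective α
  refine ⟨(ContinuousMultilinearMap.mkPiAlgebra 𝕜 (Fin n) 𝕜).compContinuousLinearMap
    fun i => ContinuousLinearMap.proj (s i), ?_, fun y => ?_⟩
  · refine ContinuousMultilinearMap.opNorm_le_bound zero_le_one fun x => ?_
    simp only [ContinuousMultilinearMap.compContinuousLinearMap_apply,
      ContinuousMultilinearMap.mkPiAlgebra_apply, ContinuousLinearMap.proj_apply, norm_prod,
      one_mul]
    exact Finset.prod_le_prod (fun _ _ => norm_nonneg _) fun i _ => norm_le_pi_norm _ _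
  · simp [Sym.prod_map_ofWord]

variable [DecidableEq σ] {F : Type*} [NormedAddCommGroup F] [NormedSpace 𝕜 F]
  (p : (σ → 𝕜) [×n]→L[𝕜] F)

theorem ContinuousMultilinearMap.apply_diag_eq_sum_words (y : σ → 𝕜) :
    p (fun _ => y) = ∑ s : Fin n → σ,
      ((Sym.ofWord s : Multiset σ).map y).prod • p fun i => Pi.single (s i) 1 := by
  have hy : y = ∑ j, y j • (Pi.single j 1 : σ → 𝕜) := by
    ext j
    simp [Finset.sum_apply, Pi.single_apply]
  conv_lhs => rw [hy, p.map_sum (fun _ j => y j • (Pi.single j 1 : σ → 𝕜))]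
  refine Finset.sum_congr rfl fun s _ => ?_
  rw [p.map_smul_univ (fun i => y (s i))]
  rw [Sym.prod_map_ofWord]

/-- The coefficient of a monomial in the homogeneous polynomial `y ↦ p (y, …, y)`. -/
noncomputable def ContinuousMultilinearMap.monomialCoeff (α : Sym σ n) : F :=
  ∑ s : Fin n → σ with Sym.ofWord s = α, p fun i => Pi.single (s i) 1

theorem ContinuousMultilinearMap.apply_diag_eq_sum_monomialCoeff (y : σ → 𝕜) :
    p (fun _ => y) = ∑ α : Sym σ n, ((α : Multiset σ).map y).prod • p.monomialCoeff α := by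
  rw [p.apply_diag_eq_sum_words, ← Finset.sum_fiberwise _ Sym.ofWord]
  refine Finset.sum_congr rfl fun α _ => ?_
  rw [monomialCoeff, Finset.smul_sum]
  refine Finset.sum_congr rfl fun s hs => ?_
  rw [(Finset.mem_filter.1 hs).2]

theorem ContinuousMultilinearMap.finsupp_sum_apply_diag {α : Sym σ n} {l : (σ → 𝕜) →₀ 𝕜}
    (hl : ∀ β : Sym σ n,
      l.sum (fun x a => a * ((β : Multiset σ).map x).prod) = if β = α then 1 else 0) :
    l.sum (fun x a => a • p fun _ => x) = p.monomialCoeff α := by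
  simp only [p.apply_diag_eq_sum_monomialCoeff, Finsupp.sum, Finset.smul_sum, smul_smul]
  rw [Finset.sum_comm]
  simp only [← Finset.sum_smul]
  simp only [Finsupp.sum] at hl
  simp [hl]

theorem ContinuousMultilinearMap.norm_monomialCoeff_le (α : Sym σ n) :
    ‖p.monomialCoeff α‖ ≤ (Fintype.card σ : ℝ) ^ n * ‖p‖ := by
  have hword (s : Fin n → σ) : ‖p fun i => Pi.single (s i) 1‖ ≤ ‖p‖ := by
    refine (p.le_opNorm _).trans_eq ?_
    simp [Pi.norm_single]
  calc ‖p.monomialCoeff α‖ ≤ ∑ s : Fin n → σ with Sym.ofWord s = α, ‖p‖ :=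
        norm_sum_le_of_le _ fun s _ => hword s
    _ ≤ ∑ s : Fin n → σ, ‖p‖ :=
        Finset.sum_le_sum_of_subset_of_nonneg (Finset.subset_univ _) fun _ _ _ => norm_nonneg _
    _ = (Fintype.card σ : ℝ) ^ n * ‖p‖ := by simp

end Monomials

theorem FormalMultilinearSeries.radius_pos_of_le_pow {𝕜 E F : Type*} [NontriviallyNormedField 𝕜]
    [NormedAddCommGroup E] [NormedSpace 𝕜 E] [NormedAddCommGroup F] [NormedSpace 𝕜 F]
    (p : FormalMultilinearSeries 𝕜 E F) {C R : ℝ} (hR : 0 ≤ R) (hp : ∀ n, ‖p n‖ ≤ C * R ^ n) :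
    0 < p.radius := by
  have hC : 0 ≤ C := by simpa using (norm_nonneg _).trans (hp 0)
  let r : NNReal := ⟨(R + 1)⁻¹, by positivity⟩
  have hr : 0 < r := by
    rw [← NNReal.coe_pos]
    exact inv_pos.2 (by positivity)
  refine (ENNReal.coe_pos.2 hr).trans_le (p.le_radius_of_bound C fun n => ?_)
  have h₁ : R * (R + 1)⁻¹ ≤ 1 := by
    rw [← div_eq_mul_inv, div_le_one (by positivity)]
    linarith
  calc ‖p n‖ * (R + 1)⁻¹ ^ n ≤ C * R ^ n * (R + 1)⁻¹ ^ n := by gcongr; exact hp n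
    _ = C * (R * (R + 1)⁻¹) ^ n := by rw [mul_pow, mul_assoc]
    _ ≤ C * 1 := by gcongr; exact pow_le_one₀ (by positivity) h₁
    _ = C := mul_one C

section SeveralVariables

variable {𝕜 σ E V W : Type*} [NontriviallyNormedField 𝕜] [Fintype σ]
  [NormedAddCommGroup E] [NormedSpace 𝕜 E] [CompleteSpace E]
  [NormedAddCommGroup V] [NormedSpace 𝕜 V] [CompleteSpace V]
  [NormedAddCommGroup W] [NormedSpace 𝕜 W]
  (B : E →L[𝕜] V →L[𝕜] W)

/-- The monomial coefficients of the weak power series of a weakly analytic function are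
represented by vectors. -/
theorem exists_monomialCoeff_of_weak_hasFPowerSeriesAt [DecidableEq σ]
    (hB : ∀ u : E, ‖B u‖ = ‖u‖) {f : (σ → 𝕜) → E} {z₀ : σ → 𝕜}
    {p : V → FormalMultilinearSeries 𝕜 (σ → 𝕜) W}
    (hp : ∀ v, HasFPowerSeriesAt (fun z => B (f z) v) (p v) z₀) (n : ℕ) (α : Sym σ n) :
    ∃ c : E, ∀ v, B c v = (p v n).monomialCoeff α := by
  have hdiag (y : σ → 𝕜) : ∃ e : E, ∀ v, B e v = p v n fun _ => y := by
    let L : 𝕜 →L[𝕜] (σ → 𝕜) := ContinuousLinearMap.toSpanSingleton 𝕜 y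
    obtain ⟨e, he⟩ := exists_coeff_of_weak_hasFPowerSeriesAt B hB n (fun t => f (z₀ + L t))
      (fun v => (p v).compContinuousLinearMap L) fun v => by
        have h₀ : HasFPowerSeriesAt (fun z => B (f (z₀ + z)) v) (p v) (L 0) := by
          simpa [sub_neg_eq_add, add_comm] using (hp v).comp_sub (-z₀)
        exact h₀.compContinuousLinearMap
    refine ⟨e, fun v => (he v).trans ?_⟩
    rw [FormalMultilinearSeries.coeff, FormalMultilinearSeries.compContinuousLinearMap_apply]
    congr 1
    funext i
    simp [L]
  choose e he using hdiag
  obtain ⟨l, hl⟩ := exists_finsupp_sum_eval_monomial (𝕜 := 𝕜) α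
  refine ⟨l.sum fun x a => a • e x, fun v => ?_⟩
  rw [← (p v n).finsupp_sum_apply_diag hl]
  simp [Finsupp.sum, he]

/-- A function of finitely many variables is analytic at a point if it is weakly analytic there with
respect to an isometric embedding into a space of operators. -/
theorem AnalyticAt.of_weak (hB : ∀ u : E, ‖B u‖ = ‖u‖) {f : (σ → 𝕜) → E} {z₀ : σ → 𝕜}
    (hf : ∀ v, AnalyticAt 𝕜 (fun z => B (f z) v) z₀) : AnalyticAt 𝕜 f z₀ := by
  classical
  choose p hp using hf
  choose c hc using exists_monomialCoeff_of_weak_hasFPowerSeriesAt B hB hp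
  choose μ hμ hμ' using fun (n : ℕ) (α : Sym σ n) => exists_multilinear_eval_monomial (𝕜 := 𝕜) α
  set d : ℝ := (Fintype.card σ : ℝ)
  obtain ⟨N, C, hC, hN⟩ := ContinuousLinearMap.exists_forall_norm_le_of_pointwise
    (fun i : Σ n, Sym σ n => B (c i.1 i.2)) (fun _ => Set.univ)
    (fun N i => (N : ℝ) * (d * N) ^ i.1) fun v => by
      obtain ⟨r, hr⟩ := hp v
      obtain ⟨C, R, hC, hR, hCR⟩ :=
        (p v).le_mul_pow_of_radius_pos (hr.r_pos.trans_le hr.r_le)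
      obtain ⟨N₁, hN₁⟩ := exists_nat_ge C
      obtain ⟨N₂, hN₂⟩ := exists_nat_ge R
      refine ⟨max N₁ N₂, fun ⟨n, α⟩ _ => ?_⟩
      have h₁ : C ≤ (max N₁ N₂ : ℕ) := hN₁.trans (by exact_mod_cast le_max_left _ _)
      have h₂ : R ≤ (max N₁ N₂ : ℕ) := hN₂.trans (by exact_mod_cast le_max_right _ _)
      calc ‖B (c n α) v‖ ≤ d ^ n * ‖p v n‖ := by
            rw [hc]
            exact (p v n).norm_monomialCoeff_le α
        _ ≤ d ^ n * (C * R ^ n) := by gcongr; exact hCR n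
        _ ≤ d ^ n * ((max N₁ N₂ : ℕ) * ((max N₁ N₂ : ℕ) : ℝ) ^ n) := by gcongr
        _ = (max N₁ N₂ : ℕ) * (d * (max N₁ N₂ : ℕ)) ^ n := by rw [mul_pow]; ring
  let q : FormalMultilinearSeries 𝕜 (σ → 𝕜) E := fun n => ∑ α, (μ n α).smulRight (c n α)
  have hq (v : V) (n : ℕ) (y : σ → 𝕜) : B (q n fun _ => y) v = p v n fun _ => y := by
    rw [(p v n).apply_diag_eq_sum_monomialCoeff]
    simp [q, hμ', hc]
  have hq_norm (n : ℕ) : ‖q n‖ ≤ C * N * (d * (d * N)) ^ n := by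
    have hterm (α : Sym σ n) : ‖(μ n α).smulRight (c n α)‖ ≤ C * (N * (d * N) ^ n) := by
      rw [ContinuousMultilinearMap.norm_smulRight, ← hB]
      exact (mul_le_of_le_one_left (norm_nonneg _) (hμ n α)).trans (hN ⟨n, α⟩ trivial)
    calc ‖q n‖ ≤ ∑ α : Sym σ n, C * (N * (d * N) ^ n) := norm_sum_le_of_le _ fun α _ => hterm α
      _ = (Fintype.card (Sym σ n) : ℝ) * (C * (N * (d * N) ^ n)) := by simp
      _ ≤ d ^ n * (C * (N * (d * N) ^ n)) := by
          gcongr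
          rw [← Nat.cast_pow]
          exact Nat.cast_le.2 Sym.card_le_pow
      _ = C * N * (d * (d * N)) ^ n := by rw [mul_pow d (d * N)]; ring
  have hq_ball := q.hasFPowerSeriesOnBall (q.radius_pos_of_le_pow (by positivity) hq_norm)
  have hweak (v : V) : ∀ᶠ y in 𝓝 0, B (f (z₀ + y) - q.sum y) v = 0 := by
    filter_upwards [(hp v).eventually_hasSum, hq_ball.hasFPowerSeriesAt.eventually_hasSum]
      with y hy hy'
    have h₁ : HasSum (fun n => p v n fun _ => y) (B (q.sum y) v) := by
      simpa [hq] using (B.flip v).hasSum hy'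
    rw [map_sub, sub_apply, hy.unique h₁, sub_self]
  obtain ⟨N', C', -, hN'⟩ := ContinuousLinearMap.exists_forall_norm_le_of_pointwise
    (fun y => B (f (z₀ + y) - q.sum y)) (fun N => Metric.ball 0 (1 / ((N : ℝ) + 1)))
    (fun _ _ => 0) fun v => by
      obtain ⟨r, hr, hball⟩ := Metric.eventually_nhds_iff_ball.1 (hweak v)
      obtain ⟨M, hM⟩ := exists_nat_one_div_lt hr
      exact ⟨M, fun y hy => by rw [hball y (Metric.ball_subset_ball hM.le hy), norm_zero]⟩
  have hfq : q.sum =ᶠ[𝓝 0] fun y => f (z₀ + y) := by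
    filter_upwards [Metric.ball_mem_nhds 0 (by positivity : 0 < 1 / ((N' : ℝ) + 1))] with y hy
    have := hN' y hy
    rw [hB, mul_zero, norm_le_zero_iff, sub_eq_zero] at this
    exact this.symm
  have hfz : HasFPowerSeriesAt (fun y => f (z₀ + y)) q 0 := hq_ball.hasFPowerSeriesAt.congr hfq
  exact ⟨q, by simpa using hfz.comp_sub z₀⟩

end SeveralVariables

/-- **Weak and strong analyticity (Proposition A1, after Browder).**  Let `𝕜` be a complete
nontrivially normed field, `E`, `V`, `W` Banach spaces over `𝕜`, and
`B : E →L[𝕜] (V →L[𝕜] W)` an isometric embedding (`‖B u‖ = ‖u‖` for all `u`).  Then a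
function `f : 𝕜^m → E` is analytic at a point `z₀` if and only if for every `v ∈ V` the
`W`-valued function `z ↦ B (f z) v` is analytic at `z₀`. -/
theorem analyticAt_iff_weak_analyticAt
    (𝕜 : Type*) [NontriviallyNormedField 𝕜] [CompleteSpace 𝕜]
    (E V W : Type*)
    [NormedAddCommGroup E] [NormedSpace 𝕜 E] [CompleteSpace E]
    [NormedAddCommGroup V] [NormedSpace 𝕜 V] [CompleteSpace V]
    [NormedAddCommGroup W] [NormedSpace 𝕜 W] [CompleteSpace W]
    (B : E →L[𝕜] V →L[𝕜] W) (hB : ∀ u : E, ‖B u‖ = ‖u‖)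
    (m : ℕ) (f : (Fin m → 𝕜) → E) (z₀ : Fin m → 𝕜) :
    AnalyticAt 𝕜 f z₀ ↔ ∀ v : V, AnalyticAt 𝕜 (fun z => B (f z) v) z₀ := by
  constructor
  · intro hf v
    exact ((B.flip v).analyticAt (f z₀)).comp hf
  · exact AnalyticAt.of_weak B hB
end

section
/- Fix integers d ≥ 1 and M ≥ 0, and set N := (2d+1)·M + d. Let I ⊆ {0,…,d} be any subset, let λ ∈ ℤ^{d+1} satisfy |λ_j| ≤ M for all j, and let μ ∈ ℤ^{d+1} be such that |μ_j| > N for some j. Choose indices u, v ∈ {0,…,d} such that μ_u is maximal and μ_v is minimal among the entries of μ. For ν ∈ ℤ^{d+1} let P(ν) denote the condition: ∑_{j=0}^{d} (ν_j − λ_j) = 0 and ν_j ≥ λ_j for every j ∉ I. Then P(μ) holds if and only if P(μ − e_u + e_v) holds, where e_u, e_v are the standard basis vectors of ℤ^{d+1}; and if either of these conditions holds, then μ_u > M+1 and μ_v < −(M+1) (in particular u ≠ v). -/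
/-- The condition that the Laurent monomial `X^(ν - λ)` lies in the coordinate ring
`𝒪(U_I)` of the intersection of the principal open subsets `D₊(X_i)`, `i ∈ I`, of
projective `d`-space: the exponents sum to zero and are nonnegative outside `I`. -/
def weightCond {d : ℕ} (I : Set (Fin (d + 1))) (lam ν : Fin (d + 1) → ℤ) : Prop :=
  (∑ j, (ν j - lam j)) = 0 ∧ ∀ j ∉ I, lam j ≤ ν j

theorem add_mul_le_sum_of_forall_le {d : ℕ} (f : Fin (d + 1) → ℤ) (i : Fin (d + 1)) {a : ℤ}
    (ha : ∀ j, a ≤ f j) : f i + d * a ≤ ∑ j, f j := by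
  rw [Fin.sum_univ_succAbove f i]
  have h := Finset.card_nsmul_le_sum Finset.univ (fun j => f (i.succAbove j)) a
    fun j _ => ha _
  simpa using h

/-- If the sum of the entries is small and some entry is very large, then every lower bound
of the entries is very negative. -/
theorem lowerBound_lt_of_large_entry {d M : ℕ} (f : Fin (d + 1) → ℤ) {i : Fin (d + 1)} {a : ℤ}
    (hsum : ∑ j, f j ≤ (d + 1) * M) (hi : ((2 * d + 1) * M + d : ℤ) < f i)
    (ha : ∀ j, a ≤ f j) : a < -((M : ℤ) + 1) := by
  have h := add_mul_le_sum_of_forall_le f i ha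
  refine lt_of_mul_lt_mul_left (a := (d : ℤ)) ?_ (Int.natCast_nonneg d)
  linarith

theorem large_max_and_small_min {d M : ℕ} (hd : 1 ≤ d) (f : Fin (d + 1) → ℤ)
    (hsum : |∑ j, f j| ≤ (d + 1) * M) (hf : ∃ j, ((2 * d + 1) * M + d : ℤ) < |f j|)
    {a b : ℤ} (hb : ∀ j, f j ≤ b) (ha : ∀ j, a ≤ f j) :
    (M : ℤ) + 1 < b ∧ a < -((M : ℤ) + 1) := by
  obtain ⟨j, hj⟩ := hf
  obtain ⟨hl, hr⟩ := abs_le.mp hsum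
  have hN : (M : ℤ) + 1 ≤ (2 * d + 1) * M + d := by
    have : (1 : ℤ) ≤ d := by exact_mod_cast hd
    have : (0 : ℤ) ≤ d * M := by positivity
    linarith
  have haj := ha j
  have hbj := hb j
  rcases lt_abs.mp hj with h | h
  · exact ⟨by linarith, lowerBound_lt_of_large_entry f hr h ha⟩
  · have hneg := lowerBound_lt_of_large_entry (M := M) (-f) (i := j) (a := -b)
      (by simp only [Pi.neg_apply, Finset.sum_neg_distrib]; linarith) h
      fun k => neg_le_neg (hb k)
    exact ⟨by linarith, by linarith⟩

theorem sum_sub_single_add_single {ι : Type*} [Fintype ι] [DecidableEq ι] (f : ι → ℤ) (u v : ι) :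
    ∑ j, (f - Pi.single u 1 + Pi.single v 1 : ι → ℤ) j = ∑ j, f j := by
  simp [Finset.sum_add_distrib]

/-- **Comparison of occurring weights (Lemma 2).**  Fix `d ≥ 1`, `M ≥ 0` and
`N = (2d+1)M + d`.  Let `|λ_j| ≤ M` for all `j`, let `μ` have some entry with `|μ_j| > N`,
and let `u`, `v` be indices where `μ` is maximal resp. minimal.  Then for any subset
`I ⊆ {0,…,d}` the monomial condition holds for `μ` iff it holds for `μ - e_u + e_v`; and if
either holds then `μ_u > M + 1` and `μ_v < -(M+1)`, in particular `u ≠ v`. -/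
theorem weightCond_shift_iff
    (d M : ℕ) (hd : 1 ≤ d)
    (I : Set (Fin (d + 1)))
    (lam : Fin (d + 1) → ℤ) (hlam : ∀ j, |lam j| ≤ (M : ℤ))
    (μ : Fin (d + 1) → ℤ) (hμ : ∃ j, ((2 * d + 1) * M + d : ℤ) < |μ j|)
    (u v : Fin (d + 1)) (hu : ∀ j, μ j ≤ μ u) (hv : ∀ j, μ v ≤ μ j) :
    (weightCond I lam μ ↔ weightCond I lam (μ - Pi.single u 1 + Pi.single v 1)) ∧
      ((weightCond I lam μ ∨ weightCond I lam (μ - Pi.single u 1 + Pi.single v 1)) →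
        (M : ℤ) + 1 < μ u ∧ μ v < -((M : ℤ) + 1) ∧ u ≠ v) := by
  have key (hs : ∑ j, μ j = ∑ j, lam j) :
      (M : ℤ) + 1 < μ u ∧ μ v < -((M : ℤ) + 1) ∧ u ≠ v := by
    have hsum : |∑ j, μ j| ≤ (d + 1) * M := by
      rw [hs]
      refine (Finset.abs_sum_le_sum_abs _ _).trans ?_
      simpa using Finset.sum_le_card_nsmul Finset.univ (fun j => |lam j|) M fun j _ => hlam j
    obtain ⟨h₁, h₂⟩ := large_max_and_small_min hd μ hsum hμ hu hv
    exact ⟨h₁, h₂, by rintro rfl; lia⟩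
  simp only [weightCond, Finset.sum_sub_distrib, sum_sub_single_add_single, sub_eq_zero]
  refine ⟨and_congr_right fun hs => ?_, fun h => key (h.elim And.left And.left)⟩
  obtain ⟨h₁, h₂, huv⟩ := key hs
  refine forall₂_congr fun j _ => ?_
  have hj := abs_le.mp (hlam j)
  by_cases hju : j = u
  · subst hju
    simp [huv]
    lia
  · by_cases hjv : j = v
    · subst hjv
      simp [hju]
      lia
    · simp [hju, hjv]
end

section
/- Fix integers d ≥ 1 and M ≥ 0, and set N := (2d+1)·M + d. Then for every μ ∈ ℤ^{d+1} there exist ν ∈ ℤ^{d+1} with |ν_j| ≤ N for all j, and a natural number k, such that for every subset I ⊆ {0,…,d} and every λ ∈ ℤ^{d+1} with |λ_j| ≤ M for all j, the following hold: (1) the condition [∑_{j=0}^{d}(μ_j − λ_j) = 0 and μ_j ≥ λ_j for all j ∉ I] is satisfied if and only if the condition [∑_{j=0}^{d}(ν_j − λ_j) = 0 and ν_j ≥ λ_j for all j ∉ I] is satisfied; and (2) whenever these equivalent conditions hold, ∑_{j=0}^{d} max(0, μ_j − λ_j) = k + ∑_{j=0}^{d} max(0, ν_j − λ_j). -/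
/-- Cancelling coordinates above `a ≥ 0` against coordinates below `b ≤ 0` keeps the sum and ends
with all coordinates `≤ a` or all coordinates `≥ b`. -/
theorem exists_sum_eq_and_le_or_ge {ι : Type*} [Fintype ι] [DecidableEq ι] {a b : ℤ}
    (ha : 0 ≤ a) (hb : b ≤ 0) (μ : ι → ℤ) :
    ∃ ν : ι → ℤ, ∑ j, ν j = ∑ j, μ j ∧
      (∀ j, ν j = μ j ∨ (a ≤ ν j ∧ ν j ≤ μ j) ∨ (μ j ≤ ν j ∧ ν j ≤ b)) ∧
      ((∀ j, ν j ≤ a) ∨ ∀ j, b ≤ ν j) := by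
  induction h : ∑ j, (μ j).toNat using Nat.strong_induction_on generalizing μ with
  | _ n ih =>
  by_cases hμ : (∀ j, μ j ≤ a) ∨ ∀ j, b ≤ μ j
  · exact ⟨μ, rfl, fun j => Or.inl rfl, hμ⟩
  push Not at hμ
  obtain ⟨⟨p, hp⟩, q, hq⟩ := hμ
  have hpq : p ≠ q := by rintro rfl; omega
  let μ' : ι → ℤ := fun j => μ j + ((if j = q then 1 else 0) - if j = p then 1 else 0)
  have hμ' : ∀ j, (j = p ∧ μ' j = μ j - 1) ∨ (j = q ∧ μ' j = μ j + 1) ∨ μ' j = μ j := by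
    intro j
    simp only [μ']
    split_ifs with h1 h2 h2
    · exact absurd (h2.symm.trans h1) hpq
    all_goals simp_all [sub_eq_add_neg]
  have hp' : μ' p = μ p - 1 := by simp [μ', hpq, sub_eq_add_neg]
  have hsum : ∑ j, μ' j = ∑ j, μ j := by
    simp [μ', Finset.sum_add_distrib]
  have hlt : ∑ j, (μ' j).toNat < n := by
    rw [← h]
    refine Finset.sum_lt_sum (fun j _ => ?_) ⟨p, Finset.mem_univ p, by omega⟩
    rcases hμ' j with ⟨rfl, h1⟩ | ⟨rfl, h1⟩ | h1 <;> omega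
  obtain ⟨ν, hν, hcases, hbd⟩ := ih _ hlt μ' rfl
  refine ⟨ν, hν.trans hsum, fun j => ?_, hbd⟩
  have := hcases j
  rcases hμ' j with ⟨rfl, h1⟩ | ⟨rfl, h1⟩ | h1 <;> omega

/-- If all coordinates are at most `a`, each is at least the total minus `a` times the number of
the other coordinates. -/
theorem sum_sub_mul_le_of_forall_le {d : ℕ} {a : ℤ} {ν : Fin (d + 1) → ℤ} (h : ∀ j, ν j ≤ a)
    (j : Fin (d + 1)) : ∑ i, ν i - d * a ≤ ν j := by
  rw [Fin.sum_univ_succAbove ν j]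
  have := Finset.sum_le_sum fun i (_ : i ∈ Finset.univ) => h (j.succAbove i)
  simp only [Finset.sum_const, Finset.card_univ, Fintype.card_fin, nsmul_eq_mul] at this
  linarith

/-- A sum of `d` integers of absolute value at most `a` has absolute value at most `d * a`. -/
theorem abs_sum_le_of_forall_abs_le {d : ℕ} {a : ℤ} {ν : Fin d → ℤ} (h : ∀ j, |ν j| ≤ a) :
    |∑ j, ν j| ≤ d * a := by
  refine (Finset.abs_sum_le_sum_abs _ _).trans ?_
  simpa using Finset.sum_le_sum fun i (_ : i ∈ Finset.univ) => h i


/-- **Existence of weight-changing data (Proposition, combinatorial core).**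
Fix `d ≥ 1`, `M ≥ 0` and `N = (2d+1)M + d`.  For every `μ ∈ ℤ^(d+1)` there exist
`ν ∈ ℤ^(d+1)` with `|ν_j| ≤ N` for all `j` and a natural number `k` such that for every
subset `I ⊆ {0,…,d}` and every `λ` with `|λ_j| ≤ M` for all `j`:
(1) `∑ (μ_j - λ_j) = 0 ∧ (∀ j ∉ I, μ_j ≥ λ_j)` holds iff the same condition holds for `ν`;
(2) whenever these equivalent conditions hold,
`∑ max 0 (μ_j - λ_j) = k + ∑ max 0 (ν_j - λ_j)`. -/
theorem exists_weight_in_box_with_uniform_degree_shift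
    (d M : ℕ) (hd : 1 ≤ d) (μ : Fin (d + 1) → ℤ) :
    ∃ (ν : Fin (d + 1) → ℤ) (k : ℕ),
      (∀ j, |ν j| ≤ ((2 * d + 1) * M + d : ℤ)) ∧
      ∀ (I : Set (Fin (d + 1))) (lam : Fin (d + 1) → ℤ), (∀ j, |lam j| ≤ (M : ℤ)) →
        ((((∑ j, (μ j - lam j)) = 0 ∧ ∀ j ∉ I, lam j ≤ μ j) ↔
            ((∑ j, (ν j - lam j)) = 0 ∧ ∀ j ∉ I, lam j ≤ ν j)) ∧
          (((∑ j, (μ j - lam j)) = 0 ∧ ∀ j ∉ I, lam j ≤ μ j) →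
            (∑ j, max 0 (μ j - lam j)) = k + ∑ j, max 0 (ν j - lam j))) := by
  by_cases hμ : |∑ j, μ j| ≤ (d + 1 : ℕ) * (M : ℤ)
  · obtain ⟨ν, hsum, hν, hbd⟩ :=
      exists_sum_eq_and_le_or_ge (a := M) (b := -M - 1) (by omega) (by omega) μ
    refine ⟨ν, (∑ j, max 0 (μ j - ν j)).toNat, fun j => ?_, fun I lam hlam => ⟨?_, fun _ => ?_⟩⟩
    · rw [← hsum, abs_le] at hμ
      push_cast at hμ
      have hd' : (1 : ℤ) ≤ d := by exact_mod_cast hd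
      have hM : (0 : ℤ) ≤ M := by positivity
      rw [abs_le]
      rcases hbd with h | h
      · have := sum_sub_mul_le_of_forall_le h j
        have := h j
        constructor <;> nlinarith
      · have := sum_sub_mul_le_of_forall_le (a := M + 1) (ν := fun j => -ν j)
          (fun j => by have := h j; omega) j
        rw [Finset.sum_neg_distrib] at this
        have := h j
        constructor <;> nlinarith
    · simp only [Finset.sum_sub_distrib, hsum]
      refine and_congr_right fun _ => forall₂_congr fun j _ => ?_
      have := abs_le.1 (hlam j)
      have := hν j
      omega
    · rw [Int.toNat_of_nonneg (Finset.sum_nonneg fun _ _ => le_max_left _ _),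
        ← Finset.sum_add_distrib]
      refine Finset.sum_congr rfl fun j _ => ?_
      have := abs_le.1 (hlam j)
      have := hν j
      omega
  · have hd' : (1 : ℤ) ≤ d := by exact_mod_cast hd
    have hM : (0 : ℤ) ≤ M := by positivity
    refine ⟨fun _ => (2 * d + 1) * M + d, 0, fun j => (abs_of_nonneg (by positivity)).le,
      fun I lam hlam => ?_⟩
    have hle := abs_sum_le_of_forall_abs_le hlam
    have h1 : ∑ j, (μ j - lam j) ≠ 0 := by
      rw [Finset.sum_sub_distrib, sub_ne_zero]
      intro h
      exact hμ (h ▸ hle)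
    have h2 : ∑ j, (((2 * d + 1) * M + d : ℤ) - lam j) ≠ 0 := by
      refine (Finset.sum_pos (fun j _ => ?_) Finset.univ_nonempty).ne'
      have := (abs_le.1 (hlam j)).2
      nlinarith
    exact ⟨iff_of_false (fun h => h1 h.1) fun h => h2 h.1, fun h => absurd h.1 h1⟩
end
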